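/- arXiv:0802.1733 — 4 statements merged into one kernel-verified Lean document; each statement's English description precedes it below -/
import Mathlib

section
/- Let G be the HNN extension of V with associated subgroups f(E), g(E) (f, g: E → V injective) and stable letter t, and let ρ: G → ℤ/k send V to 0 and t to 1. Then the kernel of ρ is isomorphic to the fundamental group of the graph of groups over the directed k-cycle Δ_k whose vertex groups are k copies V_i of V, edge groups are k copies E_i of E, and attaching maps are copies f_i: E_i → V_i, g_i: E_i → V_{i+1} of f and g. -/
/-- The defining relations for the fundamental group of a graph of groups (relative to a
spanning "tree" set `T` of edges), presented on generators `(Σ i, Gv i) ⊕ ε`: vertex-group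
multiplication relations, conjugation relations `t_e⁻¹ ι_e(x) t_e = τ_e(x)` for every edge,
and the relations killing the stable letters of tree edges. -/
def gogRels {ι ε : Type*} (Gv : ι → Type*) [∀ i, Group (Gv i)]
    (Ge : ε → Type*) [∀ e, Group (Ge e)]
    (a b : ε → ι) (fa : ∀ e, Ge e →* Gv (a e)) (fb : ∀ e, Ge e →* Gv (b e))
    (T : Set ε) : Set (FreeGroup ((Σ i, Gv i) ⊕ ε)) :=
  {r | (∃ (i : ι) (v w : Gv i),
          r = FreeGroup.of (Sum.inl ⟨i, v⟩) * FreeGroup.of (Sum.inl ⟨i, w⟩) *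
              (FreeGroup.of (Sum.inl ⟨i, v * w⟩))⁻¹) ∨
       (∃ (e : ε) (x : Ge e),
          r = (FreeGroup.of (Sum.inr e))⁻¹ * FreeGroup.of (Sum.inl ⟨a e, fa e x⟩) *
              FreeGroup.of (Sum.inr e) * (FreeGroup.of (Sum.inl ⟨b e, fb e x⟩))⁻¹) ∨
       (∃ e ∈ T, r = FreeGroup.of (Sum.inr e))}

/-- The fundamental group of a graph of groups, relative to a spanning tree `T`. -/
def gogPi1 {ι ε : Type*} (Gv : ι → Type*) [∀ i, Group (Gv i)]
    (Ge : ε → Type*) [∀ e, Group (Ge e)]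
    (a b : ε → ι) (fa : ∀ e, Ge e →* Gv (a e)) (fb : ∀ e, Ge e →* Gv (b e))
    (T : Set ε) : Type _ :=
  PresentedGroup (gogRels Gv Ge a b fa fb T)

instance {ι ε : Type*} (Gv : ι → Type*) [∀ i, Group (Gv i)]
    (Ge : ε → Type*) [∀ e, Group (Ge e)]
    (a b : ε → ι) (fa : ∀ e, Ge e →* Gv (a e)) (fb : ∀ e, Ge e →* Gv (b e))
    (T : Set ε) : Group (gogPi1 Gv Ge a b fa fb T) :=
  inferInstanceAs (Group (PresentedGroup _))

namespace HnnCycle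

section
variable {V E : Type*} [Group V] [Group E] (f g : E →* V) (k : ℕ)

/-- The fundamental group of the cycle of groups. -/
abbrev P := gogPi1 (ι := ZMod k) (ε := ZMod k) (fun _ => V) (fun _ => E)
        (fun i => i) (fun i => i + 1) (fun _ => f) (fun _ => g) {e | e ≠ -1}

/-- The relations of `P`. -/
abbrev R := gogRels (ι := ZMod k) (ε := ZMod k) (fun _ => V) (fun _ => E)
        (fun i => i) (fun i => i + 1) (fun _ => f) (fun _ => g) {e | e ≠ -1}

/-- The quotient map from the free group. -/
def mkP : FreeGroup ((Σ _ : ZMod k, V) ⊕ ZMod k) →* P f g k := PresentedGroup.mk (R f g k)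

theorem mkP_surj : Function.Surjective (mkP f g k) := PresentedGroup.mk_surjective _

theorem mkP_rel {r} (h : r ∈ R f g k) : mkP f g k r = 1 :=
  PresentedGroup.one_of_mem h

/-- Vertex group inclusion. -/
def vt (i : ZMod k) : V →* P f g k :=
  MonoidHom.mk' (fun v => mkP f g k (FreeGroup.of (Sum.inl ⟨i, v⟩))) (by
    intro v w
    have h := mkP_rel f g k (r := FreeGroup.of (Sum.inl ⟨i, v⟩) * FreeGroup.of (Sum.inl ⟨i, w⟩) *
              (FreeGroup.of (Sum.inl ⟨i, v * w⟩))⁻¹) (Or.inl ⟨i, v, w, rfl⟩)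
    rw [map_mul, map_mul, map_inv, mul_inv_eq_one] at h
    exact h.symm)

/-- Edge letters. -/
def st (i : ZMod k) : P f g k := mkP f g k (FreeGroup.of (Sum.inr i))

theorem st_tree (i : ZMod k) (h : i ≠ -1) : st f g k i = 1 :=
  mkP_rel f g k (Or.inr (Or.inr ⟨i, h, rfl⟩))

theorem st_conj (i : ZMod k) (x : E) :
    vt f g k i (f x) * st f g k i = st f g k i * vt f g k (i + 1) (g x) := by
  have h := mkP_rel f g k (r := (FreeGroup.of (Sum.inr i))⁻¹ * FreeGroup.of (Sum.inl ⟨i, f x⟩) *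
              FreeGroup.of (Sum.inr i) * (FreeGroup.of (Sum.inl ⟨i + 1, g x⟩))⁻¹)
              (Or.inr (Or.inl ⟨i, x, rfl⟩))
  rw [map_mul, map_mul, map_mul, map_inv, map_inv, mul_inv_eq_one, mul_assoc,
    inv_mul_eq_iff_eq_mul] at h
  exact h

/-- Lift a homomorphism to `P`. -/
def liftP {H : Type*} [Group H] (F : (Σ _ : ZMod k, V) ⊕ ZMod k → H)
    (h : ∀ r ∈ R f g k, FreeGroup.lift F r = 1) : P f g k →* H :=
  PresentedGroup.toGroup (rels := R f g k) h

theorem liftP_vt {H : Type*} [Group H] (F : (Σ _ : ZMod k, V) ⊕ ZMod k → H)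
    (h : ∀ r ∈ R f g k, FreeGroup.lift F r = 1) (i v) :
    liftP f g k F h (vt f g k i v) = F (Sum.inl ⟨i, v⟩) :=
  PresentedGroup.toGroup.of h

theorem liftP_st {H : Type*} [Group H] (F : (Σ _ : ZMod k, V) ⊕ ZMod k → H)
    (h : ∀ r ∈ R f g k, FreeGroup.lift F r = 1) (i) :
    liftP f g k F h (st f g k i) = F (Sum.inr i) :=
  PresentedGroup.toGroup.of h

theorem P_induction {motive : P f g k → Prop} (one : motive 1)
    (hv : ∀ i v, motive (vt f g k i v)) (hs : ∀ i, motive (st f g k i))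
    (mul : ∀ x y, motive x → motive y → motive (x * y))
    (inv : ∀ x, motive x → motive x⁻¹) (p : P f g k) : motive p := by
  obtain ⟨w, rfl⟩ := mkP_surj f g k p
  induction w using FreeGroup.induction_on with
  | C1 => simpa using one
  | of x =>
    rcases x with ⟨i, v⟩ | i
    · exact hv i v
    · exact hs i
  | inv_of x h => rw [map_inv]; exact inv _ h
  | mul x y hx hy => rw [map_mul]; exact mul _ _ hx hy

/-- The vertex group acting on `P × ZMod k`. -/
def vPerm : V →* Equiv.Perm (P f g k × ZMod k) where
  toFun v :=
    { toFun := fun q => (q.1 * (vt f g k q.2 v)⁻¹, q.2)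
      invFun := fun q => (q.1 * vt f g k q.2 v, q.2)
      left_inv := fun q => by simp
      right_inv := fun q => by simp }
  map_one' := by ext q <;> simp
  map_mul' v w := by ext q <;> simp [mul_assoc]

/-- The stable letter acting on `P × ZMod k`. -/
def tPerm : Equiv.Perm (P f g k × ZMod k) where
  toFun := fun q => (q.1 * st f g k q.2, q.2 + 1)
  invFun := fun q => (q.1 * (st f g k (q.2 - 1))⁻¹, q.2 - 1)
  left_inv := fun q => by simp
  right_inv := fun q => by simp

theorem vPerm_apply (v : V) (p i) :
    vPerm f g k v (p, i) = (p * (vt f g k i v)⁻¹, i) := rfl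

theorem tPerm_apply (p i) :
    tPerm f g k (p, i) = (p * st f g k i, i + 1) := rfl

theorem val_succ [NeZero k] (i : ZMod k) (h : i ≠ -1) : (i + 1).val = i.val + 1 := by
  have hlt := ZMod.val_lt i
  have hi : ((i.val + 1 : ℕ) : ZMod k) = i + 1 := by simp
  rw [← hi, ZMod.val_cast_of_lt]
  refine lt_of_le_of_ne hlt fun hk => h ?_
  rw [hk, ZMod.natCast_self] at hi
  exact eq_neg_of_add_eq_zero_left hi.symm

theorem tPerm_pow [NeZero k] (m : ℕ) (hm : m < k) (p : P f g k) :
    (tPerm f g k ^ m) (p, 0) = (p, (m : ZMod k)) := by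
  induction m with
  | zero => simp
  | succ m ih =>
    have hne : (m : ZMod k) ≠ -1 := by
      intro h
      have h2 : ((m + 1 : ℕ) : ZMod k) = 0 := by push_cast; rw [h]; simp
      rw [ZMod.natCast_eq_zero_iff] at h2
      exact absurd (Nat.le_of_dvd (Nat.succ_pos _) h2) (by omega)
    rw [pow_succ', Equiv.Perm.mul_apply, ih (by omega), tPerm_apply, st_tree _ _ _ _ hne]
    simp

theorem tPerm_pow_val [NeZero k] (i : ZMod k) (p : P f g k) :
    (tPerm f g k ^ i.val) (p, 0) = (p, i) := by
  rw [tPerm_pow f g k _ (ZMod.val_lt i)]; simp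

end
end HnnCycle

/-- Let G be the HNN extension of V with associated subgroups f(E), g(E) and
stable letter t, and ρ : G → ℤ/k the homomorphism sending V to 0 and t to 1.  Then ker ρ is
isomorphic to the fundamental group of the graph of groups over the directed k-cycle Δ_k
with vertex groups k copies of V, edge groups k copies of E, and attaching maps copies of
f and g (edge i runs from vertex i to vertex i+1; the spanning tree consists of all edges
except the edge from -1 to 0). -/
theorem hnn_kernel_iso_cycle_of_groups
    (V E : Type*) [Group V] [Group E]
    (f g : E →* V) (hf : Function.Injective f) (hg : Function.Injective g)
    (φ : f.range ≃* g.range)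
    (hφ : ∀ e : E, (φ ⟨f e, ⟨e, rfl⟩⟩ : V) = g e)
    (k : ℕ) (hk : 0 < k)
    (ρ : HNNExtension V f.range g.range φ →* Multiplicative (ZMod k))
    (hρV : ∀ v : V, ρ (HNNExtension.of v) = 1)
    (hρt : ρ (HNNExtension.t (G := V) (A := f.range) (B := g.range) (φ := φ)) =
      Multiplicative.ofAdd (1 : ZMod k)) :
    Nonempty (MonoidHom.ker ρ ≃*
      gogPi1 (ι := ZMod k) (ε := ZMod k) (fun _ => V) (fun _ => E)
        (fun i => i) (fun i => i + 1) (fun _ => f) (fun _ => g) {e | e ≠ -1}) := by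
  
  classical
  have : NeZero k := ⟨Nat.pos_iff_ne_zero.1 hk⟩
  let G := HNNExtension V f.range g.range φ
  let τ : G := HNNExtension.t
  let o : V →* G := HNNExtension.of
  have hrel : ∀ x : E, τ * o (f x) = o (g x) * τ := fun x => by
    have := HNNExtension.t_mul_of (φ := φ) ⟨f x, ⟨x, rfl⟩⟩
    rw [hφ x] at this
    exact this
  -- the map from the fundamental group
  let F : (Σ _ : ZMod k, V) ⊕ ZMod k → G := Sum.elim
    (fun x => (τ ^ x.1.val)⁻¹ * o x.2 * τ ^ x.1.val)
    (fun i => (τ ^ i.val)⁻¹ * τ⁻¹ * τ ^ (i + 1).val)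
  have hF : ∀ r ∈ HnnCycle.R f g k, FreeGroup.lift F r = 1 := by
    rintro r (⟨i, v, w, rfl⟩ | ⟨i, x, rfl⟩ | ⟨i, hi, rfl⟩)
    · simp only [map_mul, map_inv, FreeGroup.lift_apply_of, F, Sum.elim_inl]
      group
    · have h := hrel x
      have h4 : o (g x) = τ * o (f x) * τ⁻¹ := by rw [h]; simp
      simp only [map_mul, map_inv, FreeGroup.lift_apply_of, F, Sum.elim_inl, Sum.elim_inr]
      rw [h4]
      group
    · simp only [FreeGroup.lift_apply_of, F, Sum.elim_inr]
      rw [HnnCycle.val_succ k i hi, pow_succ']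
      group
  let Ψ : HnnCycle.P f g k →* G := HnnCycle.liftP f g k F hF
  have Ψv : ∀ i v, Ψ (HnnCycle.vt f g k i v) = (τ ^ i.val)⁻¹ * o v * τ ^ i.val :=
    fun i v => HnnCycle.liftP_vt f g k F hF i v
  have Ψs : ∀ i, Ψ (HnnCycle.st f g k i) = (τ ^ i.val)⁻¹ * τ⁻¹ * τ ^ (i + 1).val :=
    fun i => HnnCycle.liftP_st f g k F hF i
  -- the action
  let Θ : G →* Equiv.Perm (HnnCycle.P f g k × ZMod k) :=
    HNNExtension.lift (HnnCycle.vPerm f g k) (HnnCycle.tPerm f g k) (by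
      rintro ⟨_, x, rfl⟩
      rw [hφ x]
      refine Equiv.ext ?_
      rintro ⟨p, i⟩
      simp only [Equiv.Perm.mul_apply, HnnCycle.vPerm_apply, HnnCycle.tPerm_apply]
      refine Prod.ext ?_ rfl
      have h := HnnCycle.st_conj f g k i x
      change p * _ * _ = p * _ * _
      rw [mul_assoc, mul_assoc, inv_mul_eq_iff_eq_mul.2]
      rw [← mul_assoc, h, mul_assoc, mul_inv_cancel, mul_one])
  have Θv : ∀ v, Θ (o v) = HnnCycle.vPerm f g k v := fun v => HNNExtension.lift_of _ _ _ v
  have Θt : Θ τ = HnnCycle.tPerm f g k := HNNExtension.lift_t _ _ _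
  have hback : ∀ (i : ZMod k) (q : HnnCycle.P f g k),
      (HnnCycle.tPerm f g k ^ i.val)⁻¹ (q, i) = (q, 0) := fun i q => by
    rw [Equiv.Perm.inv_eq_iff_eq, HnnCycle.tPerm_pow_val]
  have key : ∀ p q, Θ (Ψ p)⁻¹ (q, 0) = (q * p, 0) := by
    intro p
    refine HnnCycle.P_induction f g k
      (motive := fun p => ∀ q, Θ (Ψ p)⁻¹ (q, 0) = (q * p, 0)) ?_ ?_ ?_ ?_ ?_ p
    · intro q; simp
    · intro i v q
      rw [Ψv]
      simp only [mul_inv_rev, inv_inv, map_mul, map_inv, map_pow, Θt, Θv, Equiv.Perm.mul_apply]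
      rw [HnnCycle.tPerm_pow_val, ← map_inv, HnnCycle.vPerm_apply, hback]
      simp
    · intro i q
      rw [Ψs]
      simp only [mul_inv_rev, inv_inv, map_mul, map_inv, map_pow, Θt, Equiv.Perm.mul_apply]
      rw [HnnCycle.tPerm_pow_val, HnnCycle.tPerm_apply, hback]
    · intro x y hx hy q
      rw [map_mul, mul_inv_rev, map_mul, Equiv.Perm.mul_apply, hx, hy, mul_assoc]
    · intro x hx q
      have h := hx (q * x⁻¹)
      rw [map_inv, Equiv.Perm.inv_eq_iff_eq, inv_mul_cancel_right] at h
      rw [map_inv Ψ, inv_inv (Ψ x), ← h]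
  have hinj : Function.Injective Ψ := by
    rw [injective_iff_map_eq_one]
    intro p hp
    have h := key p 1
    rw [hp] at h
    simp only [inv_one, map_one, Equiv.Perm.one_apply, one_mul] at h
    exact (congrArg Prod.fst h).symm
  -- the comparison of the regular action with the action on pairs
  let Φ : HnnCycle.P f g k × ZMod k → G := fun q => Ψ q.1 * (τ ^ q.2.val)⁻¹
  have hΦ : ∀ (x : G) q, Φ (Θ x q) = Φ q * x⁻¹ := by
    intro x
    refine HNNExtension.induction_on x ?_ ?_ ?_ ?_
    · rintro v ⟨p, i⟩
      change Φ (Θ (o v) _) = _ * (o v)⁻¹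
      rw [Θv, HnnCycle.vPerm_apply]
      simp only [Φ, map_mul, map_inv, Ψv]
      group
    · rintro ⟨p, i⟩
      change Φ (Θ τ _) = _ * τ⁻¹
      rw [Θt, HnnCycle.tPerm_apply]
      simp only [Φ, map_mul, Ψs]
      group
    · intro x y hx hy q
      rw [map_mul, Equiv.Perm.mul_apply, hx, hy, mul_inv_rev, mul_assoc]
    · intro x hx q
      have h := hx ((Θ x)⁻¹ q)
      rw [show Θ x ((Θ x)⁻¹ q) = q from (Θ x).apply_symm_apply q] at h
      rw [map_inv, h]
      simp
  have hsnd : ∀ (x : G) q, Multiplicative.ofAdd (Θ x q).2 = ρ x * Multiplicative.ofAdd q.2 := by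
    intro x
    refine HNNExtension.induction_on x ?_ ?_ ?_ ?_
    · rintro v ⟨p, i⟩
      change Multiplicative.ofAdd (Θ (o v) _).2 = _
      rw [Θv, HnnCycle.vPerm_apply, hρV]
      simp
    · rintro ⟨p, i⟩
      change Multiplicative.ofAdd (Θ τ _).2 = _
      rw [Θt, HnnCycle.tPerm_apply, hρt, ← ofAdd_add, add_comm]
    · intro x y hx hy q
      rw [map_mul, Equiv.Perm.mul_apply, hx, hy, map_mul, mul_assoc]
    · intro x hx q
      have h := hx ((Θ x)⁻¹ q)
      rw [show Θ x ((Θ x)⁻¹ q) = q from (Θ x).apply_symm_apply q] at h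
      rw [map_inv, map_inv, h]
      simp
  have hrange : Ψ.range = ρ.ker := by
    ext x
    rw [MonoidHom.mem_ker]
    constructor
    · rintro ⟨p, rfl⟩
      have h := hsnd (Ψ p)⁻¹ (1, 0)
      rw [key] at h
      simpa using h
    · intro hx
      have h1 := hΦ x⁻¹ (1, 0)
      have h2 := hsnd x⁻¹ (1, 0)
      rw [map_inv ρ, hx, inv_one, one_mul] at h2
      have h3 : (Θ x⁻¹ (1, 0)).2 = 0 := Multiplicative.ofAdd.injective h2
      refine ⟨(Θ x⁻¹ (1, 0)).1, ?_⟩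
      rw [inv_inv x] at h1
      simp only [Φ, h3] at h1
      simpa using h1
  exact ⟨((MonoidHom.ofInjective hinj).trans (MulEquiv.subgroupCongr hrange)).symm⟩
end

section
/- Let V, E, V_* be groups with injective homomorphisms f, g: E → V and h_i: V → V_* for i ∈ ℤ/k. Then the fundamental group of the graph of groups over the k-cycle Δ_k (vertex groups V_i ≅ V, edge groups E_i ≅ E, attaching maps f_i, g_i) embeds in the fundamental group of the graph of groups over the k-leaved rose Γ_k with single vertex group V_*, edge groups E_i, and attaching homomorphisms h_i ∘ f_i and h_{i+1} ∘ g_i. -/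
/-- A free action splits as a given invariant piece plus free orbits indexed by `W`. -/
theorem roseAux_split {E X D W : Type*} [Group E] (ρ : E →* Equiv.Perm X)
    (hfree : ∀ e x, ρ e x = x → e = 1)
    (δ : E →* Equiv.Perm D) (j : D → X) (hj : Function.Injective j)
    (hjδ : ∀ e d, j (δ e d) = ρ e (j d))
    (p : X → W) (hp : Function.Injective p)
    (q : W → X) (hq : ∀ w d, j d ≠ q w) (hqq : ∀ e w w', ρ e (q w) = q w' → w = w') :
    ∃ b : (D ⊕ (E × W)) ≃ X, (∀ d, b (Sum.inl d) = j d) ∧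
      ∀ e e' w, b (Sum.inr (e * e', w)) = ρ e (b (Sum.inr (e', w))) := by
  classical
  let S : Setoid {x : X // ∀ d, j d ≠ x} :=
    { r := fun x y => ∃ e, ρ e x.1 = y.1
      iseqv := by
        refine ⟨fun x => ⟨1, by simp⟩, ?_, ?_⟩
        · rintro x y ⟨e, he⟩
          exact ⟨e⁻¹, by rw [← he, ← Equiv.Perm.mul_apply, ← map_mul]; simp⟩
        · rintro x y z ⟨e, he⟩ ⟨e', he'⟩
          exact ⟨e' * e, by rw [map_mul, Equiv.Perm.mul_apply, he, he']⟩ }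
  let F1 : Quotient S → W := fun c => p c.out.1
  have hF1 : Function.Injective F1 := by
    intro c c' hc
    have h1 : c.out = c'.out := Subtype.ext (hp hc)
    rw [← Quotient.out_eq c, h1, Quotient.out_eq]
  let F2 : W → Quotient S := fun w => Quotient.mk S ⟨q w, hq w⟩
  have hF2 : Function.Injective F2 := by
    intro w w' hw
    obtain ⟨e, he⟩ := Quotient.exact hw
    exact hqq e w w' he
  obtain ⟨u, hu⟩ := Function.Embedding.schroeder_bernstein hF2 hF1
  let b0 : (D ⊕ (E × W)) → X := Sum.elim j (fun ew => ρ ew.1 (u ew.2).out.1)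
  have hinv : ∀ e x, (∀ d, j d ≠ x) → ∀ d, j d ≠ ρ e x := by
    intro e x hx d hd
    apply hx (δ e⁻¹ d)
    rw [hjδ, hd, ← Equiv.Perm.mul_apply, ← map_mul]; simp
  have hb : Function.Bijective b0 := by
    constructor
    · rintro (d | ⟨e, w⟩) (d' | ⟨e', w'⟩) hh
      · exact congrArg _ (hj hh)
      · exact absurd hh (hinv _ _ (u w').out.2 d)
      · exact absurd hh.symm (hinv _ _ (u w).out.2 d')
      · change ρ e (u w).out.1 = ρ e' (u w').out.1 at hh
        have h1 : ρ (e'⁻¹ * e) (u w).out.1 = (u w').out.1 := by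
          rw [map_mul, Equiv.Perm.mul_apply, hh, ← Equiv.Perm.mul_apply, ← map_mul]; simp
        have h2 : u w = u w' := by
          rw [← Quotient.out_eq (u w), ← Quotient.out_eq (u w')]
          exact Quotient.sound ⟨_, h1⟩
        have h3 : w = w' := hu.1 h2
        subst h3
        have h4 := hfree _ _ h1
        have h5 : e = e' := by
          rw [inv_mul_eq_one] at h4; exact h4.symm
        rw [h5]
    · intro x
      by_cases hx : ∃ d, j d = x
      · obtain ⟨d, hd⟩ := hx
        exact ⟨Sum.inl d, hd⟩
      · push Not at hx
        obtain ⟨w, hw⟩ := hu.2 (Quotient.mk S ⟨x, hx⟩)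
        have h1 : Quotient.mk S (u w).out = Quotient.mk S ⟨x, hx⟩ := by
          rw [Quotient.out_eq, hw]
        obtain ⟨e, he⟩ := Quotient.exact h1
        exact ⟨Sum.inr (e, w), he⟩
  refine ⟨Equiv.ofBijective b0 hb, fun d => rfl, fun e e' w => ?_⟩
  change ρ (e * e') _ = ρ e (ρ e' _)
  rw [map_mul, Equiv.Perm.mul_apply]

/-- Extension of a partial equivariant bijection to a global one. -/
theorem roseAux_extend {E X D W : Type*} [Group E] (ρ σ : E →* Equiv.Perm X)
    (hρ : ∀ e x, ρ e x = x → e = 1) (hσ : ∀ e x, σ e x = x → e = 1)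
    (δ : E →* Equiv.Perm D) (j j' : D → X) (hj : Function.Injective j)
    (hj' : Function.Injective j')
    (hjδ : ∀ e d, j (δ e d) = ρ e (j d)) (hjδ' : ∀ e d, j' (δ e d) = σ e (j' d))
    (p : X → W) (hp : Function.Injective p)
    (q : W → X) (hq : ∀ w d, j d ≠ q w) (hqq : ∀ e w w', ρ e (q w) = q w' → w = w')
    (hq' : ∀ w d, j' d ≠ q w) (hqq' : ∀ e w w', σ e (q w) = q w' → w = w') :
    ∃ τ : Equiv.Perm X, (∀ d, τ (j d) = j' d) ∧ ∀ e, τ * ρ e = σ e * τ := by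
  obtain ⟨b, hb1, hb2⟩ := roseAux_split ρ hρ δ j hj hjδ p hp q hq hqq
  obtain ⟨c, hc1, hc2⟩ := roseAux_split σ hσ δ j' hj' hjδ' p hp q hq' hqq'
  refine ⟨b.symm.trans c, fun d => ?_, fun e => ?_⟩
  · rw [← hb1, ← hc1]; simp
  · ext x
    obtain ⟨y, rfl⟩ := b.surjective x
    rcases y with d | ⟨e', w⟩
    · simp only [Equiv.Perm.mul_apply, Equiv.trans_apply, Equiv.symm_apply_apply]
      rw [hb1, ← hjδ, ← hb1, Equiv.symm_apply_apply, hc1, hc1, hjδ']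
    · simp only [Equiv.Perm.mul_apply, Equiv.trans_apply, Equiv.symm_apply_apply]
      rw [← hb2, Equiv.symm_apply_apply, hc2]

theorem roseAux_cocycle {V D : Type*} [Group V] [Group D] (α : V →* D)
    (hα : Function.Injective α) : ∃ c : D → V, ∀ v d, c (α v * d) = v * c d := by
  classical
  let S := QuotientGroup.rightRel α.range
  have hr : ∀ d : D, ∃ v : V, α v = d * (Quotient.mk S d).out⁻¹ := by
    intro d
    have h1 : S (Quotient.mk S d).out d := Quotient.exact (Quotient.out_eq _)
    exact QuotientGroup.rightRel_apply.1 h1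
  choose c hc using hr
  refine ⟨c, fun v d => hα ?_⟩
  have h1 : Quotient.mk S (α v * d) = Quotient.mk S d := by
    apply Quotient.sound
    refine QuotientGroup.rightRel_apply.2 ⟨v⁻¹, ?_⟩
    simp
  rw [map_mul, hc, hc, h1, mul_assoc]

/-- Partial products of stable letters. -/
def roseAux_s {H : Type*} [Group H] {k : ℕ} (t : ZMod k → H) (i : ZMod k) : H :=
  ((List.range i.val).map (fun m => t (m : ZMod k))).prod

theorem roseAux_s_zero {H : Type*} [Group H] {k : ℕ} (t : ZMod k → H) :
    roseAux_s t 0 = 1 := by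
  simp [roseAux_s]

theorem roseAux_val {k : ℕ} (hk : 0 < k) (i : ZMod k) (hi : i ≠ -1) :
    (i + 1).val = i.val + 1 := by
  have : NeZero k := ⟨hk.ne'⟩
  suffices hlt : i.val + 1 < k by
    have h4 : i + 1 = ((i.val + 1 : ℕ) : ZMod k) := by
      rw [Nat.cast_add, ZMod.natCast_zmod_val, Nat.cast_one]
    rw [h4, ZMod.val_natCast_of_lt hlt]
  by_contra hlt
  apply hi
  have h1 := ZMod.val_lt i
  have h2 : i.val + 1 = k := by omega
  have h3 : ((i.val + 1 : ℕ) : ZMod k) = 0 := by rw [h2]; simp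
  rw [Nat.cast_add, ZMod.natCast_zmod_val] at h3
  exact eq_neg_of_add_eq_zero_left (by simpa using h3)

theorem roseAux_s_succ {H : Type*} [Group H] {k : ℕ} (hk : 0 < k) (t : ZMod k → H)
    (i : ZMod k) (hi : i ≠ -1) : roseAux_s t (i + 1) = roseAux_s t i * t i := by
  have : NeZero k := ⟨hk.ne'⟩
  rw [roseAux_s, roseAux_val hk i hi, List.range_succ]
  simp [roseAux_s]

/-- The fundamental group of the cycle of groups. -/
abbrev CycPi {V E : Type*} [Group V] [Group E] (f g : E →* V) (k : ℕ) :=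
  gogPi1 (ι := ZMod k) (ε := ZMod k) (fun _ => V) (fun _ => E)
        (fun i => i) (fun i => i + 1) (fun _ => f) (fun _ => g) {e | e ≠ -1}

section gog

variable {ι ε : Type*} (Gv : ι → Type*) [∀ i, Group (Gv i)]
    (Ge : ε → Type*) [∀ e, Group (Ge e)]
    (a b : ε → ι) (fa : ∀ e, Ge e →* Gv (a e)) (fb : ∀ e, Ge e →* Gv (b e))
    (T : Set ε)

/-- Vertex group inclusion. -/
def gogV (i : ι) : Gv i →* gogPi1 Gv Ge a b fa fb T :=
  MonoidHom.mk' (fun v => PresentedGroup.of (rels := gogRels Gv Ge a b fa fb T)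
    (Sum.inl ⟨i, v⟩)) (by
      intro v w
      have h1 := PresentedGroup.one_of_mem (rels := gogRels Gv Ge a b fa fb T)
        (Or.inl ⟨i, v, w, rfl⟩)
      rw [map_mul, map_mul, map_inv, mul_inv_eq_one] at h1
      exact h1.symm)

/-- Stable letter. -/
def gogT (e : ε) : gogPi1 Gv Ge a b fa fb T :=
  PresentedGroup.of (rels := gogRels Gv Ge a b fa fb T) (Sum.inr e)

theorem gog_rel (e : ε) (x : Ge e) :
    (gogT Gv Ge a b fa fb T e)⁻¹ * gogV Gv Ge a b fa fb T (a e) (fa e x) *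
      gogT Gv Ge a b fa fb T e = gogV Gv Ge a b fa fb T (b e) (fb e x) := by
  have h1 := PresentedGroup.one_of_mem (rels := gogRels Gv Ge a b fa fb T)
        (Or.inr (Or.inl ⟨e, x, rfl⟩))
  rw [map_mul, map_mul, map_mul, map_inv, map_inv, mul_inv_eq_one] at h1
  exact h1

theorem gog_tree (e : ε) (he : e ∈ T) : gogT Gv Ge a b fa fb T e = 1 :=
  PresentedGroup.one_of_mem (rels := gogRels Gv Ge a b fa fb T)
        (Or.inr (Or.inr ⟨e, he, rfl⟩))

theorem gog_lift {H : Type*} [Group H] (β : ∀ i, Gv i →* H) (t : ε → H)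
    (hr : ∀ e x, (t e)⁻¹ * β (a e) (fa e x) * t e = β (b e) (fb e x))
    (ht : ∀ e ∈ T, t e = 1) :
    ∃ φ : gogPi1 Gv Ge a b fa fb T →* H,
      (∀ i v, φ (gogV Gv Ge a b fa fb T i v) = β i v) ∧
      (∀ e, φ (gogT Gv Ge a b fa fb T e) = t e) := by
  let F : ((Σ i, Gv i) ⊕ ε) → H := Sum.elim (fun s => β s.1 s.2) t
  have hF : ∀ r ∈ gogRels Gv Ge a b fa fb T, FreeGroup.lift F r = 1 := by
    rintro r (⟨i, v, w, rfl⟩ | ⟨e, x, rfl⟩ | ⟨e, he, rfl⟩)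
    · simp [F]
    · simp only [map_mul, map_inv, FreeGroup.lift_apply_of, F, Sum.elim_inl, Sum.elim_inr]
      rw [hr, mul_inv_cancel]
    · simp [F, ht e he]
  refine ⟨PresentedGroup.toGroup hF, fun i v => ?_, fun e => ?_⟩
  · exact PresentedGroup.toGroup.of hF
  · exact PresentedGroup.toGroup.of hF

theorem gog_top (K : Subgroup (gogPi1 Gv Ge a b fa fb T))
    (hv : ∀ i v, gogV Gv Ge a b fa fb T i v ∈ K) (ht : ∀ e, gogT Gv Ge a b fa fb T e ∈ K)
    (x : gogPi1 Gv Ge a b fa fb T) : x ∈ K := by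
  have h1 : Subgroup.closure (Set.range (PresentedGroup.of
      (rels := gogRels Gv Ge a b fa fb T))) ≤ K := by
    refine (Subgroup.closure_le (G := PresentedGroup (gogRels Gv Ge a b fa fb T)) K).2 ?_
    rintro _ ⟨(⟨i, v⟩ | e), rfl⟩
    · exact hv i v
    · exact ht e
  rw [PresentedGroup.closure_range_of] at h1
  exact h1 (Subgroup.mem_top x)

end gog

/-- Vertex group inclusions of the cycle of groups. -/
abbrev cycV {V E : Type*} [Group V] [Group E] (f g : E →* V) (k : ℕ) (i : ZMod k) :
    V →* CycPi f g k :=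
  gogV (ι := ZMod k) (ε := ZMod k) (fun _ => V) (fun _ => E)
        (fun i => i) (fun i => i + 1) (fun _ => f) (fun _ => g) {e | e ≠ -1} i

/-- Stable letters of the cycle of groups. -/
abbrev cycT {V E : Type*} [Group V] [Group E] (f g : E →* V) (k : ℕ) (i : ZMod k) :
    CycPi f g k :=
  gogT (ι := ZMod k) (ε := ZMod k) (fun _ => V) (fun _ => E)
        (fun i => i) (fun i => i + 1) (fun _ => f) (fun _ => g) {e | e ≠ -1} i

theorem cyc_lift {V E H : Type*} [Group V] [Group E] [Group H] (f g : E →* V) (k : ℕ)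
    (hk : 0 < k) (β : ZMod k → (V →* H)) (t : ZMod k → H)
    (hr : ∀ i x, (t i)⁻¹ * β i (f x) * t i = β (i + 1) (g x)) :
    ∃ φ : CycPi f g k →* H,
      (∀ i v, φ (cycV f g k i v) = roseAux_s t i * β i v * (roseAux_s t i)⁻¹) ∧
      (∀ i, φ (cycT f g k i) = roseAux_s t i * t i * (roseAux_s t (i + 1))⁻¹) := by
  obtain ⟨φ, h1, h2⟩ := gog_lift (ι := ZMod k) (ε := ZMod k) (fun _ => V) (fun _ => E)
        (fun i => i) (fun i => i + 1) (fun _ => f) (fun _ => g) {e | e ≠ -1}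
        (fun i => (MulAut.conj (roseAux_s t i)).toMonoidHom.comp (β i))
        (fun i => roseAux_s t i * t i * (roseAux_s t (i + 1))⁻¹)
        (by
          intro i x
          simp only [MonoidHom.comp_apply, MulEquiv.toMonoidHom_eq_coe, MonoidHom.coe_coe,
            MulAut.conj_apply]
          rw [← hr]
          group)
        (by
          intro i hi
          rw [roseAux_s_succ hk t i hi, mul_inv_cancel])
  exact ⟨φ, fun i v => by rw [h1]; simp, h2⟩

theorem cycV_injective {V E : Type*} [Group V] [Group E] (f g : E →* V)
    (hf : Function.Injective f) (hg : Function.Injective g) (k : ℕ) (hk : 0 < k)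
    (i : ZMod k) : Function.Injective (cycV f g k i) := by
  let φ : g.range ≃* f.range :=
    (MonoidHom.ofInjective hg).symm.trans (MonoidHom.ofInjective hf)
  have hφ : ∀ x : E, φ ⟨g x, x, rfl⟩ = ⟨f x, x, rfl⟩ := by
    intro x
    have h1 : (MonoidHom.ofInjective hg).symm ⟨g x, x, rfl⟩ = x := by
      rw [MulEquiv.symm_apply_eq]; rfl
    simp only [φ, MulEquiv.trans_apply, h1]; rfl
  obtain ⟨ψ, h1, -⟩ := cyc_lift f g k hk (H := HNNExtension V g.range f.range φ)
    (fun _ => HNNExtension.of) (fun _ => HNNExtension.t) (by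
      intro i x
      have h2 := HNNExtension.t_mul_of (φ := φ) ⟨g x, x, rfl⟩
      rw [hφ] at h2
      simp only at h2
      rw [mul_assoc, ← h2, inv_mul_cancel_left])
  intro v w hvw
  have h3 := congrArg ψ hvw
  rw [h1, h1] at h3
  exact HNNExtension.of_injective φ (mul_left_cancel (mul_right_cancel h3))

/-- Let V, E, V_* be groups with injective homomorphisms f, g : E → V and
h_i : V → V_* (i ∈ ℤ/k).  Then the fundamental group of the graph of groups over the
k-cycle Δ_k (vertex groups copies of V, edge groups copies of E, attaching maps copies of
f and g) embeds in the fundamental group of the graph of groups over the k-leaved rose Γ_k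
with single vertex group V_*, edge groups copies of E, and attaching maps h_i ∘ f and
h_{i+1} ∘ g. -/
theorem cycle_of_groups_embeds_in_rose
    (V E Vs : Type*) [Group V] [Group E] [Group Vs]
    (f g : E →* V) (hf : Function.Injective f) (hg : Function.Injective g)
    (k : ℕ) (hk : 0 < k)
    (h : ZMod k → (V →* Vs)) (hh : ∀ i, Function.Injective (h i)) :
    ∃ θ : gogPi1 (ι := ZMod k) (ε := ZMod k) (fun _ => V) (fun _ => E)
        (fun i => i) (fun i => i + 1) (fun _ => f) (fun _ => g) {e | e ≠ -1} →*
      gogPi1 (ι := PUnit) (ε := ZMod k) (fun _ => Vs) (fun _ => E)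
        (fun _ => PUnit.unit) (fun _ => PUnit.unit)
        (fun i => (h i).comp f) (fun i => (h (i + 1)).comp g) ∅,
      Function.Injective θ := by
  let D := CycPi f g k
  let α : ZMod k → (V →* D) := cycV f g k
  let τ : ZMod k → D := cycT f g k
  have hα : ∀ i, Function.Injective (α i) := cycV_injective f g hf hg k hk
  have hτ : ∀ i x, (τ i)⁻¹ * α i (f x) * τ i = α (i + 1) (g x) := fun i x =>
    gog_rel (ι := ZMod k) (ε := ZMod k) (fun _ => V) (fun _ => E)
        (fun i => i) (fun i => i + 1) (fun _ => f) (fun _ => g) {e | e ≠ -1} i x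
  have hτ1 : ∀ i, i ≠ -1 → τ i = 1 := fun i hi =>
    gog_tree (ι := ZMod k) (ε := ZMod k) (fun _ => V) (fun _ => E)
        (fun i => i) (fun i => i + 1) (fun _ => f) (fun _ => g) {e | e ≠ -1} i hi
  obtain ⟨θ, hθ1, hθ2⟩ := cyc_lift f g k hk
    (fun i => (gogV (ι := PUnit) (ε := ZMod k) (fun _ => Vs) (fun _ => E)
        (fun _ => PUnit.unit) (fun _ => PUnit.unit)
        (fun i => (h i).comp f) (fun i => (h (i + 1)).comp g) ∅ PUnit.unit).comp (h i))
    (gogT (ι := PUnit) (ε := ZMod k) (fun _ => Vs) (fun _ => E)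
        (fun _ => PUnit.unit) (fun _ => PUnit.unit)
        (fun i => (h i).comp f) (fun i => (h (i + 1)).comp g) ∅)
    (fun i x => gog_rel (ι := PUnit) (ε := ZMod k) (fun _ => Vs) (fun _ => E)
        (fun _ => PUnit.unit) (fun _ => PUnit.unit)
        (fun i => (h i).comp f) (fun i => (h (i + 1)).comp g) ∅ i x)
  refine ⟨θ, ?_⟩
  -- the set acted upon
  let W := List (Vs ⊕ D)
  let X := Vs × W
  let act : Vs →* Equiv.Perm X :=
    { toFun := fun v => (Equiv.mulLeft v).prodCongr (Equiv.refl W)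
      map_one' := by ext x <;> simp
      map_mul' := by intro v w; ext x <;> simp [mul_assoc] }
  have hact : ∀ v x, act v x = (v * x.1, x.2) := fun v x => rfl
  have hact1 : ∀ v x, act v x = x → v = 1 := by
    intro v x hx
    rw [hact] at hx
    simpa using congrArg Prod.fst hx
  choose c hc using fun i => roseAux_cocycle (α i) (hα i)
  let j : ZMod k → D → X := fun i d => (h i (c i d), [Sum.inr ((α i (c i d))⁻¹ * d)])
  have hj : ∀ i, Function.Injective (j i) := by
    intro i d d' hd
    have h1 : c i d = c i d' := hh i (congrArg Prod.fst hd)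
    have h2 := congrArg Prod.snd hd
    simp only [j, h1] at h2
    exact mul_left_cancel (Sum.inr.inj (List.cons.inj h2).1)
  have hjα : ∀ i v d, j i (α i v * d) = act (h i v) (j i d) := by
    intro i v d
    simp only [hact, j, hc, map_mul, mul_inv_rev]
    congr 3
    group
  let p : X → W := fun x => Sum.inl x.1 :: x.2
  have hp : Function.Injective p := by
    rintro ⟨a, l⟩ ⟨a', l'⟩ hx
    obtain ⟨h1, h2⟩ := List.cons.inj hx
    exact Prod.ext (Sum.inl.inj h1) h2
  let q : W → X := fun w => (1, Sum.inl 1 :: w)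
  have hq : ∀ i w d, j i d ≠ q w := by
    intro i w d hd
    have h2 := congrArg Prod.snd hd
    exact Sum.inr_ne_inl (List.cons.inj h2).1
  have hqq : ∀ v w w', act v (q w) = q w' → w = w' := by
    intro v w w' hw
    have h2 := congrArg Prod.snd hw
    exact (List.cons.inj h2).2
  have key : ∀ i, ∃ t : Equiv.Perm X, (∀ d, t (j (i + 1) d) = j i (τ i * d)) ∧
      ∀ e, t * act (h (i + 1) (g e)) = act (h i (f e)) * t := by
    intro i
    refine roseAux_extend (W := W) (act.comp ((h (i + 1)).comp g)) (act.comp ((h i).comp f))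
      ?_ ?_ ((MulAction.toPermHom D D).comp ((α (i + 1)).comp g))
      (j (i + 1)) (fun d => j i (τ i * d)) (hj _) ?_ ?_ ?_ p hp q (hq _) ?_ ?_ ?_
    · intro e x hx
      have := hact1 _ _ hx
      exact hg (hh (i + 1) (by simpa using this))
    · intro e x hx
      have := hact1 _ _ hx
      exact hf (hh i (by simpa using this))
    · intro d d' hd
      exact mul_left_cancel (hj i hd)
    · intro e d
      exact hjα (i + 1) (g e) d
    · intro e d
      change j i (τ i * (α (i + 1) (g e) * d)) = act (h i (f e)) (j i (τ i * d))
      rw [← hjα, ← hτ]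
      congr 1
      group
    · intro e w w' hw
      exact hqq _ w w' hw
    · intro w d
      exact hq i w _
    · intro e w w' hw
      exact hqq _ w w' hw
  choose t ht1 ht2 using key
  obtain ⟨Ψ, hΨ1, hΨ2⟩ := gog_lift (ι := PUnit) (ε := ZMod k) (fun _ => Vs) (fun _ => E)
        (fun _ => PUnit.unit) (fun _ => PUnit.unit)
        (fun i => (h i).comp f) (fun i => (h (i + 1)).comp g) ∅
        (fun _ => act) t (by
          intro i x
          have := ht2 i x
          simp only [MonoidHom.comp_apply]
          rw [mul_assoc, ← this, inv_mul_cancel_left]) (by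
          intro e he
          exact absurd he (Set.notMem_empty e))
  let s := roseAux_s t
  have hs : ∀ u : ZMod k → _, (∀ i, Ψ (u i) = t i) → ∀ i, Ψ (roseAux_s u i) = s i := by
    intro u hu i
    simp only [s, roseAux_s, map_list_prod, List.map_map]
    congr 2
    funext m
    exact hu _
  have hsj : ∀ n : ℕ, n < k → ∀ d, s (n : ZMod k) (j (n : ZMod k) d) = j 0 d := by
    intro n
    induction n with
    | zero =>
      intro _ d
      simp [s, roseAux_s_zero]
    | succ n ih =>
      intro hn d
      have hne : (n : ZMod k) ≠ -1 := by
        intro h0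
        have h1 : ((n + 1 : ℕ) : ZMod k) = 0 := by push_cast; rw [h0]; simp
        rw [ZMod.natCast_eq_zero_iff] at h1
        exact absurd (Nat.le_of_dvd (Nat.succ_pos n) h1) (by omega)
      rw [Nat.cast_succ]
      simp only [s]
      rw [roseAux_s_succ hk t _ hne, Equiv.Perm.mul_apply, ht1, hτ1 _ hne, one_mul]
      exact ih (by omega) d
  have : NeZero k := ⟨hk.ne'⟩
  have hsj' : ∀ i d, s i (j i d) = j 0 d := by
    intro i d
    have := hsj i.val (ZMod.val_lt i) d
    rwa [ZMod.natCast_zmod_val] at this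
  have hsj'' : ∀ i d, (s i)⁻¹ (j 0 d) = j i d := by
    intro i d
    rw [Equiv.Perm.inv_eq_iff_eq, hsj']
  have main : ∀ x : D, ∀ d, Ψ (θ x) (j 0 d) = j 0 (x * d) := by
    let K : Subgroup D :=
      { carrier := {x | ∀ d, Ψ (θ x) (j 0 d) = j 0 (x * d)}
        one_mem' := by intro d; simp
        mul_mem' := by
          intro x y hx hy d
          rw [map_mul, map_mul, Equiv.Perm.mul_apply, hy, hx, mul_assoc]
        inv_mem' := by
          intro x hx d
          rw [map_inv, map_inv, Equiv.Perm.inv_eq_iff_eq, hx, mul_inv_cancel_left] }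
    intro x
    refine gog_top _ _ _ _ _ _ _ K ?_ ?_ x
    · intro i v d
      change Ψ (θ (α i v)) _ = j 0 (α i v * d)
      rw [hθ1, map_mul, map_mul, map_inv, hs _ hΨ2]
      simp only [MonoidHom.comp_apply]
      rw [hΨ1, Equiv.Perm.mul_apply, Equiv.Perm.mul_apply, hsj'', ← hjα, hsj']
    · intro i d
      change Ψ (θ (τ i)) _ = j 0 (τ i * d)
      rw [hθ2, map_mul, map_mul, map_inv, hs _ hΨ2, hs _ hΨ2, hΨ2]
      rw [Equiv.Perm.mul_apply, Equiv.Perm.mul_apply, hsj'', ht1, hsj']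
  rw [injective_iff_map_eq_one]
  intro x hx
  have h1 := main x 1
  rw [hx, map_one, Equiv.Perm.one_apply, mul_one] at h1
  exact (hj 0 h1).symm
end

section
/- Every Artin HNN-extension G(S,m,φ) contains a finite-index subgroup (of some index k) that embeds into an Artin group whose set of labels is contained in L(S,m) ∪ {2, ∞}. -/
/-- The alternating word sts⋯ of length n on the letters s, t, in the free group. -/
def altWord {α : Type*} (s t : α) (n : ℕ) : FreeGroup α :=
  ((List.range n).map (fun j => if j % 2 = 0 then FreeGroup.of s else FreeGroup.of t)).prod

/-- The Artin relations of the Artin system (α, m): for each pair s ≠ t with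
m(s,t) = n < ∞, the relation sts⋯ = tst⋯ (n letters on each side). -/
def artinRels {α : Type*} (m : α → α → ℕ∞) : Set (FreeGroup α) :=
  {r | ∃ (s t : α) (n : ℕ), s ≠ t ∧ m s t = (n : ℕ∞) ∧
    r = altWord s t n * (altWord t s n)⁻¹}

/-- The Artin group A(α, m), as a presented group. -/
def ArtinGroup {α : Type*} (m : α → α → ℕ∞) : Type _ := PresentedGroup (artinRels m)

instance {α : Type*} (m : α → α → ℕ∞) : Group (ArtinGroup m) :=
  inferInstanceAs (Group (PresentedGroup _))

/-- The relations of the Artin HNN-extension G(α, m, φ): generators α together with a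
stable letter t; the Artin relations of (α, m), together with t⁻¹ s t = φ(s) for s ∈ S'. -/
def artinHNNRels {α : Type*} (m : α → α → ℕ∞) (S' : Set α) (φ : α → α) :
    Set (FreeGroup (α ⊕ Unit)) :=
  {r | (∃ (s t : α) (n : ℕ), s ≠ t ∧ m s t = (n : ℕ∞) ∧
          r = altWord (Sum.inl s) (Sum.inl t) n * (altWord (Sum.inl t) (Sum.inl s) n)⁻¹) ∨
       (∃ s ∈ S', r = (FreeGroup.of (Sum.inr ()))⁻¹ * FreeGroup.of (Sum.inl s) *
          FreeGroup.of (Sum.inr ()) * (FreeGroup.of (Sum.inl (φ s)))⁻¹)}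

/-- The Artin HNN-extension G(α, m, φ). -/
def ArtinHNN {α : Type*} (m : α → α → ℕ∞) (S' : Set α) (φ : α → α) : Type _ :=
  PresentedGroup (artinHNNRels m S' φ)

instance {α : Type*} (m : α → α → ℕ∞) (S' : Set α) (φ : α → α) :
    Group (ArtinHNN m S' φ) := inferInstanceAs (Group (PresentedGroup _))


/-! ### Alternating products and basic Artin group API -/

/-- Alternating product with `n` letters whose rightmost letter is `x`. -/
def ralt {G : Type*} [Monoid G] (x y : G) : ℕ → G
  | 0 => 1
  | n + 1 => (if Even n then x else y) * ralt x y n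

theorem map_ralt {G H F : Type*} [Monoid G] [Monoid H] [FunLike F G H] [MonoidHomClass F G H]
    (f : F) (x y : G) (n : ℕ) : f (ralt x y n) = ralt (f x) (f y) n := by
  induction n with
  | zero => simp [ralt]
  | succ n ih =>
    simp only [ralt, map_mul, ih]
    split_ifs <;> rfl

theorem altWord_succ' {α : Type*} (s t : α) (n : ℕ) :
    altWord s t (n + 1) = FreeGroup.of s * altWord t s n := by
  unfold altWord
  rw [List.range_succ_eq_map, List.map_cons, List.prod_cons, List.map_map]
  congr 2
  apply List.map_congr_left
  intro j _
  simp only [Function.comp_apply]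
  rcases Nat.mod_two_eq_zero_or_one j with h | h
  · rw [if_neg (by omega), if_pos h]
  · rw [if_pos (by omega), if_neg (by omega)]

theorem altWord_eq_ralt {α : Type*} (s t : α) (n : ℕ) :
    altWord s t n = if Even n then ralt (FreeGroup.of t) (FreeGroup.of s) n
      else ralt (FreeGroup.of s) (FreeGroup.of t) n := by
  induction n generalizing s t with
  | zero => simp [altWord, ralt]
  | succ n ih =>
    rw [altWord_succ', ih]
    by_cases h : Even n
    · have h' : ¬ Even (n + 1) := by simpa [Nat.even_add_one] using h
      simp only [if_pos h, if_neg h', ralt]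
    · have h' : Even (n + 1) := by simpa [Nat.even_add_one] using h
      simp only [if_neg h, if_pos h', ralt]

theorem altWord_rel_iff {α : Type*} {G : Type*} [Group G] (F : FreeGroup α →* G) (s t : α) (n : ℕ) :
    F (altWord s t n * (altWord t s n)⁻¹) = 1 ↔
      ralt (F (FreeGroup.of s)) (F (FreeGroup.of t)) n =
        ralt (F (FreeGroup.of t)) (F (FreeGroup.of s)) n := by
  rw [map_mul, map_inv, mul_inv_eq_one, altWord_eq_ralt s t, altWord_eq_ralt t s]
  by_cases h : Even n
  · simp only [if_pos h, map_ralt]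
    exact eq_comm
  · simp only [if_neg h, map_ralt]

namespace ArtinGroup

/-- Standard generator. -/
def gen {α : Type*} (m : α → α → ℕ∞) (a : α) : ArtinGroup m := PresentedGroup.of a

theorem gen_rel {α : Type*} {m : α → α → ℕ∞} {s t : α} {n : ℕ} (hst : s ≠ t)
    (hn : m s t = n) : ralt (gen m s) (gen m t) n = ralt (gen m t) (gen m s) n := by
  have := (altWord_rel_iff (PresentedGroup.mk (artinRels m)) s t n).1
    (PresentedGroup.one_of_mem ⟨s, t, n, hst, hn, rfl⟩)
  exact this

/-- Universal property. -/
def lift {α : Type*} {m : α → α → ℕ∞} {G : Type*} [Group G] (f : α → G)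
    (h : ∀ (s t : α) (n : ℕ), s ≠ t → m s t = n → ralt (f s) (f t) n = ralt (f t) (f s) n) :
    ArtinGroup m →* G :=
  PresentedGroup.toGroup (rels := artinRels m) (f := f) (by
    rintro r ⟨s, t, n, hst, hn, rfl⟩
    rw [altWord_rel_iff]
    simpa using h s t n hst hn)

@[simp]
theorem lift_gen {α : Type*} {m : α → α → ℕ∞} {G : Type*} [Group G] (f : α → G)
    (h : ∀ (s t : α) (n : ℕ), s ≠ t → m s t = n → ralt (f s) (f t) n = ralt (f t) (f s) n)
    (a : α) : lift f h (gen m a) = f a :=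
  PresentedGroup.toGroup.of _

theorem closure_gen {α : Type*} (m : α → α → ℕ∞) :
    Subgroup.closure (Set.range (gen m)) = ⊤ :=
  PresentedGroup.closure_range_of _

theorem hom_ext {α : Type*} {m : α → α → ℕ∞} {G : Type*} [Group G] {f g : ArtinGroup m →* G}
    (h : ∀ a, f (gen m a) = g (gen m a)) : f = g := by
  apply MonoidHom.eq_of_eqOn_dense (closure_gen m)
  rintro _ ⟨a, rfl⟩
  exact h a

/-- Functoriality for label-preserving injections. -/
def map {α β : Type*} {m : α → α → ℕ∞} {m' : β → β → ℕ∞} (f : α → β)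
    (hf : Function.Injective f) (h : ∀ s t, s ≠ t → m' (f s) (f t) = m s t) :
    ArtinGroup m →* ArtinGroup m' :=
  lift (fun a => gen m' (f a)) (fun s t n hst hn =>
    gen_rel (hf.ne hst) (by rw [h s t hst, hn]))

@[simp]
theorem map_gen {α β : Type*} {m : α → α → ℕ∞} {m' : β → β → ℕ∞} (f : α → β)
    (hf : Function.Injective f) (h : ∀ s t, s ≠ t → m' (f s) (f t) = m s t) (a : α) :
    map f hf h (gen m a) = gen m' (f a) := lift_gen _ _ _

end ArtinGroup

/-! ### Dihedral computations -/

theorem dihedral_zpow {G : Type*} [Group G] {ρ c : G} (h1 : ρ * ρ = 1) (h2 : ρ * c * ρ = c⁻¹)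
    (k : ℤ) : c ^ k * ρ = ρ * c ^ (-k) := by
  have hinv : ρ⁻¹ = ρ := inv_eq_of_mul_eq_one_left h1
  have : ρ * c ^ k * ρ⁻¹ = (ρ * c * ρ⁻¹) ^ k := by simp
  rw [hinv, h2, inv_zpow'] at this
  rw [← this, ← mul_assoc, ← mul_assoc, h1, one_mul]

theorem ralt_conj_c {G : Type*} [Group G] {ρ c : G} (h1 : ρ * ρ = 1) (h2 : ρ * c * ρ = c⁻¹)
    (k : ℕ) : ralt ρ (c * ρ) k * c * (ralt ρ (c * ρ) k)⁻¹ = if Even k then c else c⁻¹ := by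
  have hinv : ρ⁻¹ = ρ := inv_eq_of_mul_eq_one_left h1
  have h3 : ρ * c⁻¹ * ρ = c := by
    have := congrArg (·⁻¹) h2
    simpa [hinv, mul_assoc] using this
  induction k with
  | zero => simp [ralt]
  | succ k ih =>
    have e : ∀ z v : G, z * v * c * (z * v)⁻¹ = z * (v * c * v⁻¹) * z⁻¹ := by
      intro z v; group
    rw [ralt, e, ih]
    by_cases h : Even k
    · have h' : ¬ Even (k + 1) := by simpa [Nat.even_add_one] using h
      simp only [if_pos h, if_neg h', hinv, h2]
    · have h' : Even (k + 1) := by simpa [Nat.even_add_one] using h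
      simp only [if_neg h, if_pos h', mul_inv_rev, hinv]
      calc c * ρ * c⁻¹ * (ρ * c⁻¹) = c * (ρ * c⁻¹ * ρ) * c⁻¹ := by group
        _ = c := by rw [h3]; group

theorem ralt_conj {G : Type*} [Group G] {ρ c : G} (h1 : ρ * ρ = 1) (h2 : ρ * c * ρ = c⁻¹)
    (k : ℕ) : ralt ρ (c * ρ) k * (ρ * c ^ k) * (ralt ρ (c * ρ) k)⁻¹ =
      if Even k then ρ else c * ρ := by
  have hinv : ρ⁻¹ = ρ := inv_eq_of_mul_eq_one_left h1
  induction k with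
  | zero => simp [ralt]
  | succ k ih =>
    have hc := ralt_conj_c h1 h2 k
    rw [ralt]
    set v := ralt ρ (c * ρ) k
    set z := if Even k then ρ else c * ρ with hz
    have hzz : z * z = 1 := by
      rw [hz]; split_ifs
      · exact h1
      · calc c * ρ * (c * ρ) = c * (ρ * c * ρ) := by group
          _ = 1 := by rw [h2]; group
    calc z * v * (ρ * c ^ (k + 1)) * (z * v)⁻¹
        = z * (v * (ρ * c ^ k) * v⁻¹) * (v * c * v⁻¹) * z⁻¹ := by rw [pow_succ]; group
      _ = (v * c * v⁻¹) * z⁻¹ := by rw [ih, hzz, one_mul]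
      _ = _ := by
        rw [hc, hz]
        by_cases h : Even k
        · have h' : ¬ Even (k + 1) := by simpa [Nat.even_add_one] using h
          simp only [if_pos h, if_neg h', hinv]
        · have h' : Even (k + 1) := by simpa [Nat.even_add_one] using h
          simp only [if_neg h, if_pos h', mul_inv_rev, hinv]
          calc c⁻¹ * (ρ * c⁻¹) = c⁻¹ * (ρ * c⁻¹ * ρ) * ρ⁻¹ := by group
            _ = ρ := by
              have := congrArg (·⁻¹) h2
              simp only [mul_inv_rev, hinv, inv_inv, ← mul_assoc] at this
              rw [this, hinv]; group

theorem ralt_closed {G : Type*} [Group G] {ρ c : G} (h1 : ρ * ρ = 1) (i : ℕ) :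
    ralt ρ (c * ρ) (2 * i) = c ^ i ∧ ralt ρ (c * ρ) (2 * i + 1) = ρ * c ^ i := by
  induction i with
  | zero => simp [ralt]
  | succ i ih =>
    have e : ralt ρ (c * ρ) (2 * (i + 1)) = c ^ (i + 1) := by
      rw [show 2 * (i + 1) = (2 * i + 1) + 1 by ring, ralt, if_neg (by simp), ih.2]
      calc c * ρ * (ρ * c ^ i) = c * (ρ * ρ) * c ^ i := by group
        _ = _ := by rw [h1, mul_one, pow_succ']
    refine ⟨e, ?_⟩
    rw [ralt, if_pos (by simp), e]

theorem ralt_symm_of_pow {G : Type*} [Group G] {ρ c : G} (h1 : ρ * ρ = 1)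
    (h2 : ρ * c * ρ = c⁻¹) {n : ℕ} (hn : c ^ n = 1) :
    ralt ρ (c * ρ) n = ralt (c * ρ) ρ n := by
  have h1' : (c * ρ) * (c * ρ) = 1 := by
    calc c * ρ * (c * ρ) = c * (ρ * c * ρ) := by group
          _ = 1 := by rw [h2]; group
  have e : ρ = c⁻¹ * (c * ρ) := by group
  have A := ralt_closed (c := c) h1
  have B := ralt_closed (c := c⁻¹) h1'
  rw [← e] at B
  rcases Nat.even_or_odd' n with ⟨i, rfl | rfl⟩
  · rw [(A i).1, (B i).1, inv_pow, eq_inv_iff_mul_eq_one, ← pow_add, ← two_mul, hn]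
  · rw [(A i).2, (B i).2]
    have := dihedral_zpow h1 h2 i
    have h3 := dihedral_zpow h1 h2 1
    simp only [zpow_natCast, zpow_neg, zpow_one] at this h3
    rw [h3, inv_pow, mul_assoc]
    congr 1
    have : c ^ i * c ^ i * c = 1 := by rw [← pow_add, ← pow_succ, ← two_mul, hn]
    have h4 : c ^ i * (c ^ i * c) = 1 := by rw [← mul_assoc, this]
    rw [← mul_inv_rev, eq_inv_iff_mul_eq_one, h4]


/-! ### A reflection representation of a Coxeter group -/

namespace CoxRep

variable {B : Type*} (M : CoxeterMatrix B)

/-- A square root of the rotation eigenvalue. -/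
noncomputable def q (n : ℕ) : ℂ := if n = 0 then 2 else Complex.exp (Real.pi * Complex.I / n)

theorem q_ne_zero (n : ℕ) : q n ≠ 0 := by
  unfold q; split_ifs
  · norm_num
  · exact Complex.exp_ne_zero _

theorem q_sq {n : ℕ} (hn : n ≠ 0) : IsPrimitiveRoot (q n ^ 2) n := by
  have h : q n ^ 2 = Complex.exp (2 * Real.pi * Complex.I / n) := by
    rw [q, if_neg hn, ← Complex.exp_nat_mul]
    congr 1; push_cast; ring
  rw [h]
  exact Complex.isPrimitiveRoot_exp n hn

theorem q_pow_eq_one {n k : ℕ} (h : (q n ^ 2) ^ k = 1) : n ∣ k := by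
  by_cases hn : n = 0
  · subst hn
    rw [q, if_pos rfl] at h
    have h' : ((4 ^ k : ℕ) : ℂ) = 1 := by rw [← h]; push_cast; norm_num
    have h2 : 4 ^ k = 1 := by exact_mod_cast h'
    have : k = 0 := by
      by_contra hk
      have := Nat.one_lt_pow hk (by norm_num : 1 < 4)
      omega
    simp [this]
  · exact (q_sq hn).dvd_of_pow_eq_one _ h

/-- Entries of the generalized Cartan matrix. -/
noncomputable def a (i j : B) : ℂ := -(q (M i j) + (q (M i j))⁻¹)

theorem a_symm (i j : B) : a M i j = a M j i := by rw [a, a, M.symmetric]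

theorem a_self (i : B) : a M i i = 2 := by
  have : q 1 = -1 := by simp [q]
  rw [a, M.diagonal, this]; norm_num

/-- The reflection attached to a generator. -/
noncomputable def refl (i : B) : Module.End ℂ (B →₀ ℂ) :=
  LinearMap.id - (Finsupp.linearCombination ℂ (a M i)).smulRight (Finsupp.single i (1 : ℂ))

theorem refl_apply (i : B) (v : B →₀ ℂ) :
    refl M i v = v - Finsupp.linearCombination ℂ (a M i) v • Finsupp.single i (1 : ℂ) := rfl

theorem refl_single (i j : B) : refl M i (Finsupp.single j 1) =
    Finsupp.single j 1 - a M i j • Finsupp.single i (1 : ℂ) := by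
  rw [refl_apply, Finsupp.linearCombination_single, one_smul]

theorem refl_mul_self (i : B) : refl M i * refl M i = 1 := by
  ext1 j
  ext1
  simp only [LinearMap.comp_apply, Module.End.mul_apply, Finsupp.lsingle_apply, Module.End.one_apply,
    refl_single, map_sub, map_smul, a_self]
  module

theorem eig (i j : B) (p : ℂ) (hp : p ≠ 0) (ha : a M i j = -(p + p⁻¹)) :
    (refl M i * refl M j) (p • Finsupp.single i 1 + Finsupp.single j 1) =
      p ^ 2 • (p • Finsupp.single i 1 + Finsupp.single j (1 : ℂ)) := by
  simp only [Module.End.mul_apply, map_add, map_sub, map_smul, refl_single, a_self,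
    a_symm M j i, ha]
  match_scalars <;> field_simp <;> ring

theorem eig_pow (i j : B) (p : ℂ) (hp : p ≠ 0) (ha : a M i j = -(p + p⁻¹)) (k : ℕ) :
    ((refl M i * refl M j) ^ k) (p • Finsupp.single i 1 + Finsupp.single j 1) =
      (p ^ 2) ^ k • (p • Finsupp.single i 1 + Finsupp.single j (1 : ℂ)) := by
  induction k with
  | zero => simp
  | succ k ih =>
    rw [pow_succ, Module.End.mul_apply, eig M i j p hp ha, map_smul, ih, smul_smul, ← pow_succ']

theorem refl_liftable : M.IsLiftable (refl M) := by
  intro i j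
  by_cases hij : i = j
  · subst hij; rw [refl_mul_self, one_pow]
  by_cases h0 : M i j = 0
  · rw [h0, pow_zero]
  set n := M i j with hn
  have hn1 : n ≠ 1 := M.off_diagonal i j hij
  have hn2 : 1 < n := by omega
  have hprim := q_sq h0
  set p := q n with hp
  have hp0 : p ≠ 0 := q_ne_zero n
  set E := refl M i * refl M j with hE
  set Sg := ∑ k ∈ Finset.range n, E ^ k with hS
  have ha1 : a M i j = -(p + p⁻¹) := rfl
  have ha2 : a M i j = -(p⁻¹ + p⁻¹⁻¹) := by rw [ha1, inv_inv, add_comm]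
  have s1 : Sg (p • Finsupp.single i 1 + Finsupp.single j 1) = 0 := by
    rw [hS, LinearMap.sum_apply]
    simp_rw [hE, eig_pow M i j p hp0 ha1]
    rw [← Finset.sum_smul, hprim.geom_sum_eq_zero hn2, zero_smul]
  have s2 : Sg (p⁻¹ • Finsupp.single i 1 + Finsupp.single j 1) = 0 := by
    rw [hS, LinearMap.sum_apply]
    simp_rw [hE, eig_pow M i j p⁻¹ (inv_ne_zero hp0) ha2]
    have : IsPrimitiveRoot (p⁻¹ ^ 2) n := by rw [inv_pow]; exact hprim.inv
    rw [← Finset.sum_smul, this.geom_sum_eq_zero hn2, zero_smul]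
  have hne : p - p⁻¹ ≠ 0 := by
    intro h
    apply hprim.ne_one hn2
    have := sub_eq_zero.1 h
    rw [pow_two]; nth_rewrite 2 [this]; exact mul_inv_cancel₀ hp0
  have s3 : Sg (Finsupp.single i 1) = 0 := by
    have : (p - p⁻¹) • Sg (Finsupp.single i 1) = 0 := by
      rw [← map_smul, show (p - p⁻¹) • Finsupp.single i (1 : ℂ) =
        (p • Finsupp.single i 1 + Finsupp.single j 1) -
        (p⁻¹ • Finsupp.single i 1 + Finsupp.single j 1) by module, map_sub, s1, s2, sub_zero]
    exact (smul_eq_zero.1 this).resolve_left hne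
  have s4 : Sg (Finsupp.single j 1) = 0 := by
    rw [map_add, map_smul, s3, smul_zero, zero_add] at s1
    exact s1
  have key : Sg * (E - 1) = E ^ n - 1 := geom_sum_mul E n
  rw [← sub_eq_zero, ← key]
  apply LinearMap.ext
  intro v
  have : (E - 1) v = (-(Finsupp.linearCombination ℂ (a M i) (refl M j v))) • Finsupp.single i 1
      + (-(Finsupp.linearCombination ℂ (a M j) v)) • Finsupp.single j (1 : ℂ) := by
    rw [LinearMap.sub_apply, hE, Module.End.mul_apply, refl_apply M i, Module.End.one_apply]
    nth_rewrite 1 [refl_apply M j]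
    module
  rw [Module.End.mul_apply, this, map_add, map_smul, map_smul, s3, s4]
  simp

end CoxRep

section Cox

variable {B : Type*} {M : CoxeterMatrix B} {W : Type*} [Group W] (cs : CoxeterSystem M W)

theorem cox_order (i j : B) : orderOf (cs.simple i * cs.simple j) = M i j := by
  apply Nat.dvd_antisymm (orderOf_dvd_of_pow_eq_one (cs.simple_mul_simple_pow i j))
  by_cases hij : i = j
  · subst hij; simp
  have h := congrArg (cs.lift ⟨_, CoxRep.refl_liftable M⟩)
    (pow_orderOf_eq_one (cs.simple i * cs.simple j))
  rw [map_pow, map_mul, cs.lift_apply_simple, cs.lift_apply_simple, map_one] at h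
  have h2 := CoxRep.eig_pow M i j _ (CoxRep.q_ne_zero (M i j)) rfl
    (orderOf (cs.simple i * cs.simple j))
  rw [h] at h2
  apply CoxRep.q_pow_eq_one
  have h3 := DFunLike.congr_fun h2 j
  simpa [hij, Ne.symm hij] using h3.symm

theorem cox_simple_injective : Function.Injective cs.simple := by
  intro i j h
  by_contra hij
  have := cox_order cs i j
  rw [h, cs.simple_mul_simple_self, orderOf_one] at this
  exact M.off_diagonal i j hij this.symm

theorem cox_mem_parabolic {X : Set B} {i : B}
    (h : cs.simple i ∈ Subgroup.closure (cs.simple '' X)) : i ∈ X := by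
  by_contra hi
  let R := cs.lift ⟨_, CoxRep.refl_liftable M⟩
  have hR : ∀ j, R (cs.simple j) = CoxRep.refl M j := fun j => cs.lift_apply_simple _ j
  have key : ∀ y ∈ Subgroup.closure (cs.simple '' X), ∀ v, (R y v) i = v i := by
    intro y hy
    induction hy using Subgroup.closure_induction with
    | mem y hy =>
      obtain ⟨j, hj, rfl⟩ := hy
      intro v
      have : j ≠ i := fun e => hi (e ▸ hj)
      rw [hR, CoxRep.refl_apply]
      simp [this]
    | one => simp
    | mul x y _ _ hx hy =>
      intro v
      rw [map_mul, Module.End.mul_apply, hx, hy]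
    | inv x _ hx =>
      intro v
      rw [← hx, ← Module.End.mul_apply, ← map_mul]
      simp
  have := key _ h (Finsupp.single i 1)
  rw [hR, CoxRep.refl_single, CoxRep.a_self] at this
  simp at this

/-! ### The inversion cocycle -/

open Classical in
/-- The generator action on signed reflections. -/
noncomputable def etaGen (i : B) : Function.End (W × ZMod 2) := fun z =>
  (cs.simple i * z.1 * cs.simple i, z.2 + if z.1 = cs.simple i then 1 else 0)

open Classical in
theorem etaGen_pow (i j : B) (n : ℕ) (z : W × ZMod 2) :
    ((etaGen cs i * etaGen cs j) ^ n) z =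
      ((cs.simple i * cs.simple j) ^ n * z.1 * ((cs.simple i * cs.simple j) ^ n)⁻¹,
        z.2 + ∑ l ∈ Finset.range (2 * n),
          if z.1 = cs.simple j * (cs.simple i * cs.simple j) ^ l then 1 else 0) := by
  induction n with
  | zero => simp; rfl
  | succ n ih =>
    set c := cs.simple i * cs.simple j with hc
    have hj := cs.simple_mul_simple_self j
    have hi := cs.simple_mul_simple_self i
    have h2 : cs.simple j * c * cs.simple j = c⁻¹ := by
      rw [hc, mul_inv_rev, cs.inv_simple, cs.inv_simple, mul_assoc, mul_assoc, hj, mul_one]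
    rw [pow_succ']
    change (etaGen cs i * etaGen cs j) (((etaGen cs i * etaGen cs j) ^ n) z) = _
    rw [ih]
    change etaGen cs i (etaGen cs j _) = _
    have hd := dihedral_zpow hj h2 (n : ℤ)
    have hd1 := dihedral_zpow hj h2 (-(n : ℤ))
    simp only [zpow_natCast, zpow_neg, neg_neg] at hd hd1
    have e1 : c ^ n * z.1 * (c ^ n)⁻¹ = cs.simple j ↔ z.1 = cs.simple j * c ^ (2 * n) := by
      rw [mul_inv_eq_iff_eq_mul, ← eq_inv_mul_iff_mul_eq, ← mul_assoc, hd1, mul_assoc, ← pow_add,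
        two_mul]
    have e2 : cs.simple j * (c ^ n * z.1 * (c ^ n)⁻¹) * cs.simple j = cs.simple i ↔
        z.1 = cs.simple j * c ^ (2 * n + 1) := by
      have e3 : cs.simple j * (c ^ n * z.1 * (c ^ n)⁻¹) * cs.simple j = cs.simple i ↔
          c ^ n * z.1 * (c ^ n)⁻¹ = cs.simple j * c := by
        rw [← cs.inv_simple j, mul_inv_eq_iff_eq_mul, inv_mul_eq_iff_eq_mul, cs.inv_simple]
      rw [e3, mul_inv_eq_iff_eq_mul, ← eq_inv_mul_iff_mul_eq, ← mul_assoc, ← mul_assoc, hd1,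
        mul_assoc, mul_assoc, ← pow_succ', ← pow_add]
      rw [show n + (n + 1) = 2 * n + 1 by ring]
    simp only [etaGen, e1, e2]
    rw [show 2 * (n + 1) = 2 * n + 1 + 1 by ring, Finset.sum_range_succ, Finset.sum_range_succ]
    refine Prod.ext ?_ ?_
    · have : c⁻¹ = cs.simple j * cs.simple i := by
        rw [hc, mul_inv_rev, cs.inv_simple, cs.inv_simple]
      simp only [pow_succ', mul_inv_rev, this]
      simp only [hc, mul_assoc]
    · simp only [add_assoc]

theorem etaGen_liftable : M.IsLiftable (etaGen cs) := by
  classical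
  intro i j
  funext z
  rw [etaGen_pow, cs.simple_mul_simple_pow, two_mul, Finset.sum_range_add]
  simp only [pow_add, cs.simple_mul_simple_pow, one_mul, inv_one, mul_one]
  rw [CharTwo.add_self_eq_zero, add_zero]
  rfl

/-- The action on signed reflections. -/
noncomputable def etaHom : W →* Function.End (W × ZMod 2) := cs.lift ⟨_, etaGen_liftable cs⟩

/-- The inversion cocycle. -/
noncomputable def eta (w r : W) : ZMod 2 := (etaHom cs w (r, 0)).2

open Classical in
theorem etaHom_simple (i : B) (z : W × ZMod 2) : etaHom cs (cs.simple i) z =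
    (cs.simple i * z.1 * cs.simple i, z.2 + if z.1 = cs.simple i then 1 else 0) := by
  rw [etaHom, cs.lift_apply_simple]; rfl

theorem etaHom_mul (u v : W) (z : W × ZMod 2) :
    etaHom cs (u * v) z = etaHom cs u (etaHom cs v z) := by
  rw [map_mul]; rfl

theorem etaHom_apply (w : W) (z : W × ZMod 2) :
    etaHom cs w z = (w * z.1 * w⁻¹, z.2 + eta cs w z.1) := by
  classical
  induction w using cs.simple_induction_left generalizing z with
  | one =>
    have h1 : ∀ y : W × ZMod 2, etaHom cs 1 y = y := fun y => by rw [map_one]; rfl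
    unfold eta
    rw [h1, h1]
    simp
  | mul_simple_left w i ih =>
    unfold eta
    rw [etaHom_mul, etaHom_mul, ih, ih (z.1, 0), etaHom_simple, etaHom_simple]
    simp [mul_assoc, add_assoc]

theorem eta_mul (u v r : W) : eta cs (u * v) r = eta cs v r + eta cs u (v * r * v⁻¹) := by
  rw [eta, etaHom_mul, etaHom_apply, etaHom_apply]
  simp

open Classical in
theorem eta_simple (i : B) (r : W) : eta cs (cs.simple i) r = if r = cs.simple i then 1 else 0 := by
  rw [eta, etaHom_simple]; simp

theorem eta_one (r : W) : eta cs 1 r = 0 := by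
  rw [eta, map_one]; rfl

open Classical in
theorem eta_word (ω : List B) (r : W) :
    eta cs (cs.wordProd ω) r = ((cs.rightInvSeq ω).count r : ZMod 2) := by
  induction ω with
  | nil => simp [eta_one]
  | cons i ω ih =>
    rw [cs.wordProd_cons, eta_mul, ih, eta_simple, CoxeterSystem.rightInvSeq, List.count_cons]
    push_cast
    congr 1
    have : cs.wordProd ω * r * (cs.wordProd ω)⁻¹ = cs.simple i ↔
        ((cs.wordProd ω)⁻¹ * cs.simple i * cs.wordProd ω == r) = true := by
      rw [beq_iff_eq, mul_inv_eq_iff_eq_mul, ← eq_inv_mul_iff_mul_eq, ← mul_assoc, eq_comm]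
    by_cases h : cs.wordProd ω * r * (cs.wordProd ω)⁻¹ = cs.simple i
    · rw [if_pos h, if_pos (this.1 h)]
    · rw [if_neg h, if_neg (fun h' => h (this.2 h'))]

open Classical in
theorem simple_of_eta {x : W} (h : ∀ r, eta cs x r = if r = x then 1 else 0) :
    ∃ i, x = cs.simple i := by
  obtain ⟨ω, hω, rfl⟩ := cs.exists_isReduced x
  have hnd := hω.nodup_rightInvSeq
  have hall : ∀ r ∈ cs.rightInvSeq ω, r = cs.wordProd ω := by
    intro r hr
    by_contra hne
    have := h r
    rw [eta_word, List.count_eq_one_of_mem hnd hr, if_neg hne] at this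
    simp at this
  match ω, hall, hnd, h with
  | [], _, _, h =>
    have := h 1
    simp [eta_one] at this
  | [i], _, _, _ => exact ⟨i, by simp⟩
  | i :: j :: ω, hall, hnd, _ =>
    exfalso
    simp only [CoxeterSystem.rightInvSeq] at hall hnd
    have h1 := hall _ (List.mem_cons_self)
    have h2 := hall _ (List.mem_cons_of_mem _ List.mem_cons_self)
    rw [List.nodup_cons] at hnd
    apply hnd.1
    rw [h1, ← h2]
    exact List.mem_cons_self

/-! ### Minimal coset representatives -/

variable (X : Set B)

/-- The parabolic subgroup. -/
def par : Subgroup W := Subgroup.closure (cs.simple '' X)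

/-- Minimal coset representatives. -/
def minRep : Set W := {w | ∀ r ∈ par cs X, eta cs w r = 0}

theorem eta_par {y : W} (hy : y ∈ par cs X) {r : W} (hr : r ∉ par cs X) : eta cs y r = 0 := by
  classical
  unfold par at hy
  induction hy using Subgroup.closure_induction generalizing r with
  | mem y hy =>
    obtain ⟨j, hj, rfl⟩ := hy
    rw [eta_simple, if_neg]
    rintro rfl
    exact hr (Subgroup.subset_closure ⟨j, hj, rfl⟩)
  | one => exact eta_one cs r
  | mul x y hx hy ihx ihy =>
    rw [eta_mul, ihy hr, ihx, add_zero]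
    intro h
    apply hr
    have := (par cs X).mul_mem ((par cs X).mul_mem ((par cs X).inv_mem hy) h) hy
    simpa [mul_assoc] using this
  | inv x hx ih =>
    have h1 : x⁻¹ * r * x ∉ par cs X := by
      intro h
      apply hr
      have := (par cs X).mul_mem ((par cs X).mul_mem hx h) ((par cs X).inv_mem hx)
      simpa [mul_assoc] using this
    have h2 := eta_mul cs x⁻¹ x (x⁻¹ * r * x)
    rw [inv_mul_cancel, eta_one, ih h1, zero_add] at h2
    rw [h2]
    congr 1; group

theorem minRep_one : (1 : W) ∈ minRep cs X := fun r _ => eta_one cs r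

theorem minRep_simple {w : W} (hw : w ∈ minRep cs X) (i : B)
    (h : w⁻¹ * cs.simple i * w ∈ par cs X) : ∃ j ∈ X, w⁻¹ * cs.simple i * w = cs.simple j := by
  classical
  have h1 : ∀ r, eta cs (w⁻¹ * cs.simple i * w) r = if r = w⁻¹ * cs.simple i * w then 1 else 0 := by
    set x := w⁻¹ * cs.simple i * w with hx
    intro r
    by_cases hr : r ∈ par cs X
    · have e : cs.simple i * w = w * x := by rw [hx]; group
      have h2 := congrArg (fun u => eta cs u r) e
      simp only [eta_mul, hw r hr, eta_simple] at h2
      rw [hw (x * r * x⁻¹) ((par cs X).mul_mem ((par cs X).mul_mem h hr) ((par cs X).inv_mem h)),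
        add_zero, zero_add] at h2
      rw [← h2]
      congr 1
      rw [hx, eq_iff_iff, mul_inv_eq_iff_eq_mul, mul_assoc, eq_inv_mul_iff_mul_eq]
    · rw [eta_par cs X h hr, if_neg]
      rintro rfl
      exact hr h
  obtain ⟨j, hj⟩ := simple_of_eta cs h1
  refine ⟨j, ?_, hj⟩
  rw [hj] at h
  exact cox_mem_parabolic cs h

theorem minRep_mul {w : W} (hw : w ∈ minRep cs X) (i : B)
    (h : w⁻¹ * cs.simple i * w ∉ par cs X) : cs.simple i * w ∈ minRep cs X := by
  classical
  intro r hr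
  rw [eta_mul, hw r hr, eta_simple, if_neg, add_zero]
  intro e
  apply h
  rw [← e]
  simpa [mul_assoc] using hr

end Cox


/-! ### Van der Lek's theorem: the action -/

section Track

variable {W A : Type*} [Group W] [Group A] (H : Subgroup W) (Bf : W → A)

open Classical in
/-- The basic move. -/
noncomputable def stepF (s : W) (z : W × A) : W × A :=
  if z.1⁻¹ * s * z.1 ∈ H then (z.1, Bf (z.1⁻¹ * s * z.1) * z.2) else (s * z.1, z.2)

open Classical in
/-- The basic move as a permutation. -/
noncomputable def stepP (s : W) (hs : s * s = 1) : Equiv.Perm (W × A) where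
  toFun := stepF H Bf s
  invFun z := if z.1⁻¹ * s * z.1 ∈ H then (z.1, (Bf (z.1⁻¹ * s * z.1))⁻¹ * z.2)
    else (s * z.1, z.2)
  left_inv z := by
    have hinv : s⁻¹ = s := inv_eq_of_mul_eq_one_left hs
    have e : (s * z.1)⁻¹ * s * (s * z.1) = z.1⁻¹ * s * z.1 := by group
    by_cases h : z.1⁻¹ * s * z.1 ∈ H
    · simp only [stepF, if_pos h, inv_mul_cancel_left]
    · simp only [stepF, if_neg h, e]
      simp only [← mul_assoc, hs, one_mul]
  right_inv z := by
    have hinv : s⁻¹ = s := inv_eq_of_mul_eq_one_left hs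
    have e : (s * z.1)⁻¹ * s * (s * z.1) = z.1⁻¹ * s * z.1 := by group
    by_cases h : z.1⁻¹ * s * z.1 ∈ H
    · simp only [stepF, if_pos h, mul_inv_cancel_left]
    · simp only [stepF, if_neg h, e]
      simp only [← mul_assoc, hs, one_mul]

theorem stepP_apply (s : W) (hs : s * s = 1) (z : W × A) :
    stepP H Bf s hs z = stepF H Bf s z := rfl

theorem perm_ralt_succ {Z : Type*} (P Q : Equiv.Perm Z) (l : ℕ) (z : Z) :
    ralt P Q (l + 1) z = (if Even l then P else Q) (ralt P Q l z) := rfl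

theorem track_conj {si sj w : W} (hi : si * si = 1) (hj : sj * sj = 1) (l : ℕ) :
    (ralt si sj l * w)⁻¹ * (if Even l then si else sj) * (ralt si sj l * w) =
      (w⁻¹ * si * w) * (w⁻¹ * (sj * si) * w) ^ l := by
  have e : sj * si * si = sj := by rw [mul_assoc, hi, mul_one]
  have h2 : si * (sj * si) * si = (sj * si)⁻¹ := by
    rw [eq_inv_iff_mul_eq_one]
    calc si * (sj * si) * si * (sj * si) = si * sj * (si * si) * sj * si := by group
      _ = si * (sj * sj) * si := by rw [hi]; group
      _ = 1 := by rw [hj, mul_one, hi]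
  have h := ralt_conj hi h2 l
  rw [e] at h
  rw [← h]
  have e2 : (w⁻¹ * (sj * si) * w) ^ l = w⁻¹ * (sj * si) ^ l * w := by
    have := conj_pow (i := l) (a := w⁻¹) (b := sj * si)
    simpa using this
  rw [e2]
  group

theorem dihedral_rel {si sj w : W} (hi : si * si = 1) (hj : sj * sj = 1) :
    (w⁻¹ * si * w) * (w⁻¹ * si * w) = 1 ∧
    (w⁻¹ * si * w) * (w⁻¹ * (sj * si) * w) * (w⁻¹ * si * w) = (w⁻¹ * (sj * si) * w)⁻¹ := by
  constructor
  · calc _ = w⁻¹ * (si * si) * w := by group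
      _ = 1 := by rw [hi]; group
  · rw [eq_inv_iff_mul_eq_one]
    calc _ = w⁻¹ * (si * sj * (si * si) * sj * si) * w := by group
      _ = w⁻¹ * (si * (sj * sj) * si) * w := by rw [hi]; group
      _ = 1 := by rw [hj, mul_one, hi]; group

theorem dihedral_shift {ρ c : W} (h1 : ρ * ρ = 1) (h2 : ρ * c * ρ = c⁻¹) (a d : ℤ) :
    (ρ * c ^ a) * (ρ * c ^ a) = 1 ∧ (ρ * c ^ a) * c ^ d * (ρ * c ^ a) = (c ^ d)⁻¹ ∧
    c ^ d * (ρ * c ^ a) = ρ * c ^ (a - d) := by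
  have h := dihedral_zpow h1 h2
  refine ⟨?_, ?_, ?_⟩
  · calc _ = ρ * (c ^ a * ρ) * c ^ a := by group
      _ = ρ * ρ * (c ^ (-a) * c ^ a) := by rw [h]; group
      _ = 1 := by rw [h1]; group
  · calc _ = ρ * (c ^ (a + d) * ρ) * c ^ a := by group
      _ = ρ * ρ * (c ^ (-(a + d)) * c ^ a) := by rw [h]; group
      _ = _ := by rw [h1]; group
  · rw [← mul_assoc, h, mul_assoc, ← zpow_add]
    congr 2; ring

theorem track_empty {si sj w : W} (hi : si * si = 1) (hj : sj * sj = 1)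
    (hE : ∀ z : ℤ, (w⁻¹ * si * w) * (w⁻¹ * (sj * si) * w) ^ z ∉ H) (g : A) (l : ℕ) :
    ralt (stepP H Bf si hi) (stepP H Bf sj hj) l (w, g) = (ralt si sj l * w, g) := by
  induction l with
  | zero => simp [ralt]
  | succ l ih =>
    have hc := track_conj (w := w) hi hj l
    have hl := hE l
    rw [zpow_natCast] at hl
    rw [perm_ralt_succ, ih, ralt]
    by_cases h : Even l
    · simp only [if_pos h] at hc ⊢
      rw [stepP_apply, stepF, if_neg (by simpa only [hc] using hl)]
      simp only [mul_assoc]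
    · simp only [if_neg h] at hc ⊢
      rw [stepP_apply, stepF, if_neg (by simpa only [hc] using hl)]
      simp only [mul_assoc]

theorem track {si sj w : W} (hi : si * si = 1) (hj : sj * sj = 1) {ρ c x y : W}
    (hρ : w⁻¹ * si * w = ρ) (hc : w⁻¹ * (sj * si) * w = c) {d a : ℕ} (had : a < d)
    (hE : ∀ z : ℤ, ρ * c ^ z ∈ H ↔ (d : ℤ) ∣ z - a)
    (hx : x = ρ * c ^ a) (hy : y = c ^ d * x) (g : A) (l : ℕ) : ∀ k, l ≤ a + d * k →
    a + d * k < l + d →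
    ralt (stepP H Bf si hi) (stepP H Bf sj hj) l (w, g) =
      (ralt si sj l * w * (ralt x y k)⁻¹, ralt (Bf x) (Bf y) k * g) := by
  obtain ⟨r1, r2⟩ := dihedral_rel (w := w) hi hj
  rw [hρ, hc] at r2
  rw [hρ] at r1
  obtain ⟨x1, x2, x3⟩ := dihedral_shift r1 r2 a d
  simp only [zpow_natCast] at x1 x2 x3
  have hxH : x ∈ H := by
    have := (hE a).2 (by simp)
    rwa [zpow_natCast, ← hx] at this
  have hyH : y ∈ H := by
    have := (hE (a - d)).2 (by simp)
    rwa [← x3, ← hx, ← hy] at this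
  rw [← hx] at x1 x2 x3
  have hV : ∀ k, ralt x y k ∈ H := by
    intro k
    induction k with
    | zero => exact H.one_mem
    | succ k ih =>
      rw [ralt]
      refine H.mul_mem ?_ ih
      split_ifs <;> assumption
  induction l with
  | zero =>
    intro k h1 h2
    have : k = 0 := by
      rcases Nat.eq_zero_or_pos k with h | h
      · exact h
      · nlinarith
    subst this
    simp [ralt]
  | succ l ih =>
    intro k h1 h2
    have hcj := track_conj (w := w) hi hj l
    rw [hρ, hc] at hcj
    rw [perm_ralt_succ]
    set a' := if Even l then si else sj with ha'
    have hP : ∀ z, (if Even l then stepP H Bf si hi else stepP H Bf sj hj) z = stepF H Bf a' z := by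
      intro z; rw [ha']; split_ifs <;> rfl
    have hcond : ∀ k, (ralt si sj l * w * (ralt x y k)⁻¹)⁻¹ * a' * (ralt si sj l * w * (ralt x y k)⁻¹)
        = ralt x y k * (ρ * c ^ l) * (ralt x y k)⁻¹ := by
      intro k; rw [← hcj]; group
    have hmem : ∀ k, ralt x y k * (ρ * c ^ l) * (ralt x y k)⁻¹ ∈ H ↔ (d : ℤ) ∣ l - a := by
      intro k
      rw [H.mul_mem_cancel_right (H.inv_mem (hV k)), H.mul_mem_cancel_left (hV k), ← zpow_natCast,
        hE]
    rw [hP]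
    by_cases hk : a + d * k = l + d
    · obtain ⟨k, rfl⟩ : ∃ k', k = k' + 1 := by
        cases k with
        | zero => omega
        | succ k => exact ⟨k, rfl⟩
      have hl : l = a + d * k := by rw [mul_add] at hk; omega
      rw [ih k hl.le (by omega), stepF]
      simp only [hcond]
      have hm := (hmem k).2 ⟨k, by rw [hl]; push_cast; ring⟩
      rw [if_pos (by rw [hcond]; exact hm)]
      have hlab : ralt x y k * (ρ * c ^ l) * (ralt x y k)⁻¹ = if Even k then x else y := by
        have := ralt_conj x1 x2 k
        rw [← hy] at this
        rw [← this, hl, pow_add, pow_mul, ← mul_assoc ρ, ← hx]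
      refine Prod.ext ?_ ?_
      · change ralt si sj l * w * (ralt x y k)⁻¹ = ralt si sj (l + 1) * w * (ralt x y (k + 1))⁻¹
        rw [ralt, ralt, ← hlab, ← hcond, ← ha']
        group
      · change Bf (ralt x y k * (ρ * c ^ l) * (ralt x y k)⁻¹) * (ralt (Bf x) (Bf y) k * g) =
          ralt (Bf x) (Bf y) (k + 1) * g
        rw [hlab, ralt, ← mul_assoc]
        split_ifs <;> rfl
    · rw [ih k (by omega) (by omega), stepF]
      simp only [hcond]
      have hm : ¬ (ralt x y k * (ρ * c ^ l) * (ralt x y k)⁻¹ ∈ H) := by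
        rw [hmem]
        rintro ⟨q, hq⟩
        have q1 : (l : ℤ) = a + d * q := by linarith
        have q2 : (a : ℤ) + d * q < a + d * k := by rw [← q1]; norm_cast
        have q3 : (a : ℤ) + d * k < a + d * q + d := by rw [← q1]; norm_cast; omega
        have hd0 : (0 : ℤ) < d := by norm_cast; omega
        have q4 : q < k := by nlinarith
        have q5 : (k : ℤ) < q + 1 := by nlinarith
        omega
      rw [if_neg (by rw [hcond]; exact hm)]
      refine Prod.ext ?_ rfl
      change a' * (ralt si sj l * w * (ralt x y k)⁻¹) = ralt si sj (l + 1) * w * (ralt x y k)⁻¹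
      rw [ralt, ← ha']
      group

end Track


/-! ### Van der Lek's theorem: braid relations and conclusion -/

section Braid

theorem zpow_mem_dvd {W : Type*} [Group W] (H : Subgroup W) {c : W} {n : ℕ} (hn : 0 < n)
    (hc : c ^ n = 1) : ∃ d : ℕ, 0 < d ∧ ∀ z : ℤ, c ^ z ∈ H ↔ (d : ℤ) ∣ z := by
  classical
  have hex : ∃ d : ℕ, 0 < d ∧ c ^ d ∈ H := ⟨n, hn, by rw [hc]; exact H.one_mem⟩
  obtain ⟨hd, hdH⟩ := Nat.find_spec hex
  set d := Nat.find hex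
  have hmin : ∀ e : ℕ, 0 < e → c ^ e ∈ H → d ≤ e := fun e h1 h2 => Nat.find_min' hex ⟨h1, h2⟩
  refine ⟨d, hd, fun z => ⟨fun hz => ?_, ?_⟩⟩
  · have hd' : (0 : ℤ) < d := by exact_mod_cast hd
    have h0 := Int.emod_nonneg z hd'.ne'
    have h1 := Int.emod_lt_of_pos z hd'
    have h2 := Int.emod_add_mul_ediv z d
    have h3 : c ^ (z % d) ∈ H := by
      have : z % d = z + d * (-(z / d)) := by linarith
      rw [this, zpow_add, zpow_mul, zpow_natCast]
      exact H.mul_mem hz (H.zpow_mem hdH _)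
    apply Int.dvd_of_emod_eq_zero
    obtain ⟨e, he⟩ := Int.eq_ofNat_of_zero_le h0
    rw [he] at h3 h1 ⊢
    rw [zpow_natCast] at h3
    by_contra hne
    have := hmin e (by omega) h3
    omega
  · rintro ⟨q, rfl⟩
    rw [zpow_mul, zpow_natCast]
    exact H.zpow_mem hdH _

variable {B : Type*} {M : CoxeterMatrix B} {W : Type*} [Group W] (cs : CoxeterSystem M W)
variable {β A : Type*} [Group A] (ι : β → B) (gb : β → A)

open Classical in
/-- Labels of simple reflections. -/
noncomputable def labB (r : W) : A := if h : ∃ b, r = cs.simple (ι b) then gb h.choose else 1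

theorem labB_simple (hι : Function.Injective ι) (b : β) :
    labB cs ι gb (cs.simple (ι b)) = gb b := by
  have h : ∃ b', cs.simple (ι b) = cs.simple (ι b') := ⟨b, rfl⟩
  rw [labB, dif_pos h]
  congr 1
  exact (hι (cox_simple_injective cs h.choose_spec)).symm

/-- The permutation attached to a generator. -/
noncomputable def genP (i : B) : Equiv.Perm (W × A) :=
  stepP (par cs (Set.range ι)) (labB cs ι gb) (cs.simple i) (cs.simple_mul_simple_self i)

theorem genP_minRep (i : B) (z : W × A) :
    z.1 ∈ minRep cs (Set.range ι) → (genP cs ι gb i z).1 ∈ minRep cs (Set.range ι) := by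
  intro hz
  rw [genP, stepP_apply, stepF]
  split_ifs with h
  · exact hz
  · exact minRep_mul cs _ hz i h

theorem genP_ralt_minRep (i j : B) (l : ℕ) (z : W × A) (hz : z.1 ∈ minRep cs (Set.range ι)) :
    (ralt (genP cs ι gb i) (genP cs ι gb j) l z).1 ∈ minRep cs (Set.range ι) := by
  induction l with
  | zero => exact hz
  | succ l ih =>
    rw [perm_ralt_succ]
    split_ifs
    · exact genP_minRep cs ι gb i _ ih
    · exact genP_minRep cs ι gb j _ ih

theorem label_simple {i j : B} {w : W} (hw : w ∈ minRep cs (Set.range ι)) {ρ c : W}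
    (hρ : w⁻¹ * cs.simple i * w = ρ) (hc : w⁻¹ * (cs.simple j * cs.simple i) * w = c)
    {d a : ℕ} (had : a < d)
    (hE : ∀ z : ℤ, ρ * c ^ z ∈ par cs (Set.range ι) ↔ (d : ℤ) ∣ z - a) :
    ∃ b, ρ * c ^ a = cs.simple (ι b) := by
  have hi := cs.simple_mul_simple_self i
  have hj := cs.simple_mul_simple_self j
  have h := track (par cs (Set.range ι)) (fun _ => (1 : Multiplicative ℤ)) hi hj hρ hc had hE rfl
    rfl 1 a 0 (by omega) (by omega)
  have hm : (ralt (cs.simple i) (cs.simple j) a * w) ∈ minRep cs (Set.range ι) := by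
    have h2 := track (par cs (Set.range ι)) (labB cs ι (fun _ => (1 : Multiplicative ℤ))) hi hj hρ
      hc had hE rfl rfl 1 a 0 (by omega) (by omega)
    have h3 := genP_ralt_minRep cs ι (fun _ => (1 : Multiplicative ℤ)) i j a (w, 1) hw
    rw [genP, genP, h2] at h3
    simpa [ralt] using h3
  have hcj := track_conj (w := w) hi hj a
  rw [hρ, hc] at hcj
  have hmem : ρ * c ^ a ∈ par cs (Set.range ι) := by
    have := (hE a).2 (by simp)
    rwa [zpow_natCast] at this
  have hif : (if Even a then cs.simple i else cs.simple j) =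
    cs.simple (if Even a then i else j) := by split_ifs <;> rfl
  rw [hif] at hcj
  rw [← hcj] at hmem
  obtain ⟨_, ⟨b, rfl⟩, hb⟩ := minRep_simple cs _ hm _ hmem
  exact ⟨b, by rw [← hcj, hb]⟩

theorem genP_braid (hι : Function.Injective ι)
    (hgb : ∀ b b', b ≠ b' → M (ι b) (ι b') ≠ 0 →
      ralt (gb b) (gb b') (M (ι b) (ι b')) = ralt (gb b') (gb b) (M (ι b) (ι b')))
    {i j : B} (hij0 : M i j ≠ 0) {w : W} (hw : w ∈ minRep cs (Set.range ι)) (g : A) :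
    ralt (genP cs ι gb i) (genP cs ι gb j) (M i j) (w, g) =
      ralt (genP cs ι gb j) (genP cs ι gb i) (M i j) (w, g) := by
  have hi := cs.simple_mul_simple_self i
  have hj := cs.simple_mul_simple_self j
  set n := M i j with hn
  have hn0 : 0 < n := Nat.pos_of_ne_zero hij0
  set H := par cs (Set.range ι) with hH
  obtain ⟨ρ, hρ⟩ : ∃ ρ, w⁻¹ * cs.simple i * w = ρ := ⟨_, rfl⟩
  obtain ⟨c, hc⟩ : ∃ c, w⁻¹ * (cs.simple j * cs.simple i) * w = c := ⟨_, rfl⟩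
  obtain ⟨r1, r2⟩ := dihedral_rel (w := w) hi hj
  rw [hρ, hc] at r2
  rw [hρ] at r1
  have hρ' : w⁻¹ * cs.simple j * w = c * ρ := by
    rw [← hc, ← hρ]
    calc w⁻¹ * cs.simple j * w = w⁻¹ * cs.simple j * 1 * w := by group
      _ = _ := by rw [← hi]; group
  have hc' : w⁻¹ * (cs.simple i * cs.simple j) * w = c⁻¹ := by
    rw [← hc]; simp [mul_assoc]
  have hord : orderOf c = n := by
    rw [hn, M.symmetric i j, ← cox_order cs j i, ← hc]
    have := orderOf_injective (MulAut.conj w⁻¹).toMonoidHom (MulAut.conj w⁻¹).injective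
      (cs.simple j * cs.simple i)
    simpa using this
  have hcn : c ^ n = 1 := by rw [← hord]; exact pow_orderOf_eq_one c
  have hU : ralt (cs.simple i) (cs.simple j) n = ralt (cs.simple j) (cs.simple i) n := by
    have e : cs.simple j = (cs.simple j * cs.simple i) * cs.simple i := by rw [mul_assoc, hi, mul_one]
    obtain ⟨-, u2⟩ := dihedral_rel (w := 1) hi hj
    simp only [inv_one, one_mul, mul_one] at u2
    rw [e]
    apply ralt_symm_of_pow hi u2
    rw [hn, M.symmetric i j]
    exact cs.simple_mul_simple_pow j i
  have hsh : ∀ z : ℤ, c * ρ * (c⁻¹) ^ z = ρ * c ^ (-1 - z) := by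
    intro z
    have := (dihedral_shift r1 r2 (-z) 1).2.2
    rw [zpow_one] at this
    rw [inv_zpow', mul_assoc, this]
    congr 2; ring
  by_cases hemp : ∀ z : ℤ, ρ * c ^ z ∉ H
  · rw [genP, genP, track_empty, track_empty, hU]
    · intro z
      rw [hρ', hc', hsh]
      exact hemp _
    · intro z
      rw [hρ, hc]
      exact hemp _
  · push Not at hemp
    obtain ⟨z0, hz0⟩ := hemp
    obtain ⟨d, hd0, hd⟩ := zpow_mem_dvd H hn0 hcn
    have hd0' : (0 : ℤ) < d := by exact_mod_cast hd0
    obtain ⟨a, ha⟩ := Int.eq_ofNat_of_zero_le (Int.emod_nonneg z0 hd0'.ne')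
    have had : a < d := by
      have := Int.emod_lt_of_pos z0 hd0'
      rw [ha] at this
      exact_mod_cast this
    have hz0a : (d : ℤ) ∣ z0 - a := by
      rw [← ha]; exact Int.dvd_self_sub_emod
    have hE : ∀ z : ℤ, ρ * c ^ z ∈ H ↔ (d : ℤ) ∣ z - a := by
      intro z
      have : ρ * c ^ z = ρ * c ^ z0 * c ^ (z - z0) := by rw [mul_assoc, ← zpow_add]; congr 2; ring
      rw [this, H.mul_mem_cancel_left hz0, hd, ← dvd_add_left hz0a]
      congr! 1; ring
    have hE2 : ∀ z : ℤ, c * ρ * (c⁻¹) ^ z ∈ H ↔ (d : ℤ) ∣ z - (d - 1 - a : ℕ) := by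
      intro z
      rw [hsh, hE, ← dvd_neg]
      have : -(-1 - z - (a : ℤ)) = z - (d - 1 - a : ℕ) + d := by
        rw [Nat.sub_sub, Nat.cast_sub (by omega)]; push_cast; ring
      rw [this, dvd_add_self_right]
    obtain ⟨bx, hbx⟩ := label_simple cs ι hw hρ hc had hE
    obtain ⟨by', hby⟩ := label_simple cs ι hw hρ' hc' (by omega) hE2
    obtain ⟨x1, x2, x3⟩ := dihedral_shift r1 r2 a d
    simp only [zpow_natCast] at x1 x2 x3
    set x := ρ * c ^ a with hx
    set y := c * ρ * c⁻¹ ^ (d - 1 - a) with hy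
    have hyx : y = c ^ d * x := by
      have := hsh (d - 1 - a : ℕ)
      rw [zpow_natCast, ← hy] at this
      rw [this, x3]
      congr 2
      rw [Nat.sub_sub, Nat.cast_sub (by omega)]; push_cast; ring
    have hxy : x = c⁻¹ ^ d * y := by rw [hyx, inv_pow]; group
    obtain ⟨K, hK⟩ : d ∣ n := by
      have := (hd n).1 (by rw [zpow_natCast, hcn]; exact H.one_mem)
      exact_mod_cast this
    have hK0 : K ≠ 0 := by rintro rfl; omega
    rw [genP, genP, track H _ hi hj hρ hc had hE hx hyx g n K (by omega) (by omega),
      track H _ hj hi hρ' hc' (by omega) hE2 hy hxy g n K (by omega) (by omega), hU]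
    have hcK : (c ^ d) ^ K = 1 := by rw [← pow_mul, ← hK, hcn]
    have hV : ralt x y K = ralt y x K := by
      rw [hyx]; exact ralt_symm_of_pow x1 x2 hcK
    rw [hV]
    have hlab : ralt (labB cs ι gb x) (labB cs ι gb y) K =
        ralt (labB cs ι gb y) (labB cs ι gb x) K := by
      rw [hbx, hby, labB_simple cs ι gb hι, labB_simple cs ι gb hι]
      by_cases hb : bx = by'
      · rw [hb]
      · have hMK : M (ι bx) (ι by') = K := by
          rw [M.symmetric, ← cox_order cs, ← hbx, ← hby, hyx, mul_assoc, x1, mul_one,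
            orderOf_pow_of_dvd hd0.ne' (by rw [hord]; exact ⟨K, hK⟩), hord, hK,
            Nat.mul_div_cancel_left _ hd0]
        have := hgb bx by' hb (by rw [hMK]; exact hK0)
        rwa [hMK] at this
    rw [hlab]

end Braid

/-- The Coxeter matrix of an Artin system. -/
noncomputable def artinCox {α : Type*} [DecidableEq α] (m : α → α → ℕ∞)
    (hs : ∀ a b, m a b = m b a) (h2 : ∀ a b, a ≠ b → 2 ≤ m a b) : CoxeterMatrix α where
  M := fun i j => if i = j then 1 else (m i j).toNat
  isSymm := by
    ext i j
    change (if j = i then 1 else (m j i).toNat) = (if i = j then 1 else (m i j).toNat)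
    by_cases h : i = j
    · subst h; simp
    · simp [h, Ne.symm h, hs i j]
  diagonal := by simp
  off_diagonal i j hij := by
    simp only [if_neg hij]
    have := h2 i j hij
    intro h
    cases hm : m i j with
    | top => simp [hm] at h
    | coe n =>
      rw [hm] at h this
      simp at h
      subst h
      exact absurd this (by decide)

theorem vanDerLek {α β : Type*} {m : α → α → ℕ∞} {mβ : β → β → ℕ∞}
    (hs : ∀ a b, m a b = m b a) (h2 : ∀ a b, a ≠ b → 2 ≤ m a b) (ι : β → α)
    (hι : Function.Injective ι) (h : ∀ s t, s ≠ t → m (ι s) (ι t) = mβ s t) :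
    Function.Injective (ArtinGroup.map ι hι h) := by
  classical
  let M := artinCox m hs h2
  have hM : ∀ i j, i ≠ j → M i j = (m i j).toNat := fun i j hij => if_neg hij
  let cs := M.toCoxeterSystem
  let gb := ArtinGroup.gen mβ
  let X := Set.range ι
  have hgb : ∀ b b', b ≠ b' → M (ι b) (ι b') ≠ 0 →
      ralt (gb b) (gb b') (M (ι b) (ι b')) = ralt (gb b') (gb b) (M (ι b) (ι b')) := by
    intro b b' hb h0
    apply ArtinGroup.gen_rel hb
    rw [hM _ _ (hι.ne hb), h b b' hb] at h0 ⊢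
    rw [ENat.natCast_toNat]
    intro htop
    rw [htop] at h0
    simp at h0
  let P : α → Equiv.Perm (M.Group × ArtinGroup mβ) := genP cs ι gb
  have hP : ∀ i z, z.1 ∈ minRep cs X ↔ (P i z).1 ∈ minRep cs X := by
    intro i z
    refine ⟨genP_minRep cs ι gb i z, fun hz => ?_⟩
    by_cases hc : z.1⁻¹ * cs.simple i * z.1 ∈ par cs X
    · have : P i z = (z.1, labB cs ι gb (z.1⁻¹ * cs.simple i * z.1) * z.2) := if_pos hc
      rw [this] at hz
      exact hz
    · have : P i z = (cs.simple i * z.1, z.2) := if_neg hc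
      rw [this] at hz
      have h3 := minRep_mul cs X hz i (by
        intro h4; apply hc
        simpa [mul_assoc] using h4)
      simpa [← mul_assoc] using h3
  let Q : α → Equiv.Perm {z : M.Group × ArtinGroup mβ // z.1 ∈ minRep cs X} := fun i =>
    (P i).subtypePerm (fun z => (hP i z).symm)
  have hQ : ∀ i j l z, ((ralt (Q i) (Q j) l z : {z : M.Group × ArtinGroup mβ // z.1 ∈ minRep cs X}) :
      M.Group × ArtinGroup mβ) = ralt (P i) (P j) l z.1 := by
    intro i j l z
    induction l with
    | zero => rfl
    | succ l ih =>
      rw [perm_ralt_succ, perm_ralt_succ, ← ih]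
      split_ifs <;> rfl
  let F : ArtinGroup m →* Equiv.Perm {z : M.Group × ArtinGroup mβ // z.1 ∈ minRep cs X} :=
    ArtinGroup.lift Q (by
      intro i j n hij hn
      have hn' : M i j = n := by rw [hM i j hij, hn]; rfl
      have hn0 : M i j ≠ 0 := by
        have := h2 i j hij
        rw [hn] at this
        rw [hn']
        rintro rfl
        exact absurd this (by decide)
      ext1 z
      apply Subtype.ext
      rw [hQ, hQ, ← hn']
      exact genP_braid cs ι gb hι hgb hn0 z.2 z.1.2)
  have hF : ∀ (g x : ArtinGroup mβ), (F (ArtinGroup.map ι hι h g) ⟨(1, x), minRep_one cs X⟩) =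
      ⟨(1, g * x), minRep_one cs X⟩ := by
    let base : ArtinGroup mβ → {z : M.Group × ArtinGroup mβ // z.1 ∈ minRep cs X} := fun x =>
      ⟨(1, x), minRep_one cs X⟩
    let N : Subgroup (ArtinGroup mβ) :=
      { carrier := {g | ∀ x, F (ArtinGroup.map ι hι h g) (base x) = base (g * x)}
        one_mem' := fun x => by simp
        mul_mem' := fun {a b} ha hb x => by
          rw [map_mul, map_mul, Equiv.Perm.mul_apply, hb, ha, mul_assoc]
        inv_mem' := fun {a} ha x => by
          rw [map_inv, map_inv, Equiv.Perm.inv_eq_iff_eq, ha, mul_inv_cancel_left] }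
    have hN : N = ⊤ := by
      rw [eq_top_iff, ← ArtinGroup.closure_gen, Subgroup.closure_le]
      rintro _ ⟨b, rfl⟩ x
      rw [ArtinGroup.map_gen, ArtinGroup.lift_gen]
      apply Subtype.ext
      change P (ι b) (1, x) = (1, gb b * x)
      have hb : (1 : M.Group)⁻¹ * cs.simple (ι b) * 1 ∈ par cs X := by
        simp only [inv_one, one_mul, mul_one]
        exact Subgroup.subset_closure ⟨_, ⟨b, rfl⟩, rfl⟩
      have : P (ι b) (1, x) = (1, labB cs ι gb ((1 : M.Group)⁻¹ * cs.simple (ι b) * 1) * x) := if_pos hb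
      rw [this]
      simp only [inv_one, one_mul, mul_one, labB_simple cs ι gb hι]
    intro g x
    exact (hN ▸ Subgroup.mem_top g : g ∈ N) x
  intro g g' hgg
  have e1 := hF g 1
  have e2 := hF g' 1
  rw [hgg, e2] at e1
  have := congrArg (fun z => z.1.2) e1
  simpa using this.symm


/-! ### Injectivity between HNN extensions -/

theorem hnn_injective {G P : Type*} [Group G] [Group P] {A B : Subgroup G} {A2 B2 : Subgroup P}
    (φ : A ≃* B) (φ2 : A2 ≃* B2) (f : G →* P) (hf : Function.Injective f)
    (hA : ∀ g, f g ∈ A2 → g ∈ A) (hB : ∀ g, f g ∈ B2 → g ∈ B)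
    (F : HNNExtension G A B φ →* HNNExtension P A2 B2 φ2)
    (hof : ∀ g, F (HNNExtension.of g) = HNNExtension.of (f g))
    (ht : F HNNExtension.t = HNNExtension.t) : Function.Injective F := by
  rw [injective_iff_map_eq_one]
  intro x hx
  obtain ⟨d⟩ := HNNExtension.NormalWord.TransversalPair.nonempty G A B
  obtain ⟨w, rfl⟩ := (HNNExtension.NormalWord.equiv φ d).symm.surjective x
  change F (w.prod φ) = 1 at hx
  change w.prod φ = 1
  have hsub : ∀ (u : ℤˣ) (g : G), f g ∈ HNNExtension.toSubgroup A2 B2 u →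
      g ∈ HNNExtension.toSubgroup A B u := by
    intro u g hg
    rcases Int.units_eq_one_or u with rfl | rfl
    · exact hA g hg
    · exact hB g hg
  let w2 : HNNExtension.NormalWord.ReducedWord P A2 B2 :=
    { head := f w.head
      toList := w.toList.map (fun p => (p.1, f p.2))
      chain := by
        rw [List.isChain_map]
        exact w.chain.imp (fun a b h h' => h (hsub _ _ h')) }
  have hprod : w2.prod φ2 = F (w.prod φ) := by
    simp only [HNNExtension.NormalWord.ReducedWord.prod, map_mul, hof, w2, map_list_prod,
      List.map_map]
    congr 2
    apply List.map_congr_left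
    intro a _
    simp [hof, ht]
  have hnil := HNNExtension.ReducedWord.toList_eq_nil_of_mem_of_range φ2 w2
    (by rw [hprod, hx]; exact Subgroup.one_mem _)
  have hnil' : w.toList = [] := by simpa [w2] using hnil
  have hw : w.prod φ = HNNExtension.of w.head := by
    simp [HNNExtension.NormalWord.ReducedWord.prod, hnil']
  rw [hw, hof] at hx
  have h1 : f w.head = 1 := HNNExtension.of_injective φ2 (by rw [hx, map_one])
  have h2 : w.head = 1 := hf (by rw [h1, map_one])
  rw [hw, h2, map_one]


/-! ### The core construction -/

/-- Automorphisms induced by a label-preserving action. -/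
noncomputable def ArtinGroup.permAut {α C : Type*} [Group C] {m : α → α → ℕ∞}
    (τ : C →* Equiv.Perm α) (h : ∀ c s t, s ≠ t → m (τ c s) (τ c t) = m s t) :
    C →* MulAut (ArtinGroup m) where
  toFun c := MonoidHom.toMulEquiv (ArtinGroup.map (τ c) (τ c).injective (h c))
    (ArtinGroup.map (τ c⁻¹) (τ c⁻¹).injective (h c⁻¹))
    (ArtinGroup.hom_ext (fun a => by simp)) (ArtinGroup.hom_ext (fun a => by simp))
  map_one' := by
    apply MulEquiv.toMonoidHom_injective
    apply ArtinGroup.hom_ext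
    intro a
    change ArtinGroup.map (τ 1) (τ 1).injective (h 1) (ArtinGroup.gen m a) = ArtinGroup.gen m a
    simp
  map_mul' c c' := by
    apply MulEquiv.toMonoidHom_injective
    apply ArtinGroup.hom_ext
    intro a
    change ArtinGroup.map (τ (c * c')) (τ (c * c')).injective (h (c * c')) (ArtinGroup.gen m a) =
      ArtinGroup.map (τ c) (τ c).injective (h c) (ArtinGroup.map (τ c') (τ c').injective (h c') (ArtinGroup.gen m a))
    simp

theorem ArtinGroup.permAut_gen {α C : Type*} [Group C] {m : α → α → ℕ∞}
    (τ : C →* Equiv.Perm α) (h : ∀ c s t, s ≠ t → m (τ c s) (τ c t) = m s t) (c : C) (a : α) :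
    ArtinGroup.permAut τ h c (ArtinGroup.gen m a) = ArtinGroup.gen m (τ c a) :=
  ArtinGroup.map_gen (τ c) (τ c).injective (h c) a

open Classical in
/-- The labels of the extended Artin system. -/
noncomputable def extLab {T0 C : Type*} [Group C] (m0 : T0 → T0 → ℕ∞) (ρ : C →* Equiv.Perm T0)
    (Z : Set T0) : T0 ⊕ C → T0 ⊕ C → ℕ∞
  | Sum.inl x, Sum.inl y => m0 x y
  | Sum.inl x, Sum.inr c => if ρ c⁻¹ x ∈ Z then 2 else ⊤
  | Sum.inr c, Sum.inl x => if ρ c⁻¹ x ∈ Z then 2 else ⊤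
  | Sum.inr _, Sum.inr _ => ⊤

/-- The action on the extended Artin system. -/
def extAct {T0 C : Type*} [Group C] (ρ : C →* Equiv.Perm T0) : C →* Equiv.Perm (T0 ⊕ C) where
  toFun c := Equiv.sumCongr (ρ c) (Equiv.mulLeft c)
  map_one' := by ext (x | x) <;> simp
  map_mul' c d := by ext (x | x) <;> simp [mul_assoc]

theorem extAct_lab {T0 C : Type*} [Group C] {m0 : T0 → T0 → ℕ∞} {ρ : C →* Equiv.Perm T0}
    (hρ : ∀ c s t, s ≠ t → m0 (ρ c s) (ρ c t) = m0 s t) (Z : Set T0) (c : C) (s t : T0 ⊕ C)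
    (hst : s ≠ t) : extLab m0 ρ Z (extAct ρ c s) (extAct ρ c t) = extLab m0 ρ Z s t := by
  classical
  have e : ∀ d x, ρ (c * d)⁻¹ (ρ c x) = ρ d⁻¹ x := by
    intro d x
    rw [← Equiv.Perm.mul_apply, ← map_mul]
    simp
  rcases s with x | d <;> rcases t with y | d'
  · exact hρ c x y (fun h => hst (by rw [h]))
  · change (if ρ (c * d')⁻¹ (ρ c x) ∈ Z then (2 : ℕ∞) else ⊤) = if ρ d'⁻¹ x ∈ Z then (2 : ℕ∞) else ⊤
    rw [e]
  · change (if ρ (c * d)⁻¹ (ρ c y) ∈ Z then (2 : ℕ∞) else ⊤) = if ρ d⁻¹ y ∈ Z then (2 : ℕ∞) else ⊤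
    rw [e]
  · rfl

theorem ralt_two_of_comm {G : Type*} [Group G] {x y : G} (h : x * y = y * x) :
    ralt x y 2 = ralt y x 2 := by
  simp [ralt, h]

theorem comm_of_ralt_two {G : Type*} [Group G] {x y : G} (h : ralt x y 2 = ralt y x 2) :
    x * y = y * x := by
  simpa [ralt] using h.symm

theorem group_aux1 {G : Type*} [Group G] (a b c : G) :
    a * (b * c * b⁻¹) * b = a * b * c := by group

theorem group_aux2 {G : Type*} [Group G] (a b c : G) :
    a * (b * c * b⁻¹) * a⁻¹ = a * b * c * (a * b)⁻¹ := by group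

theorem group_aux3 {G : Type*} [Group G] (a b : G) :
    1 * (a * b⁻¹) * 1⁻¹ * b = a := by group

theorem core (S : Type) [Fintype S] (m : S → S → ℕ∞)
    (S' : Set S) (φ : S → S)
    (T0 : Type) [Fintype T0] (m0 : T0 → T0 → ℕ∞)
    (hs0 : ∀ a b, m0 a b = m0 b a) (h20 : ∀ a b, a ≠ b → 2 ≤ m0 a b)
    (hlab : ∀ a b, a ≠ b → m0 a b = 2 ∨ m0 a b = ⊤ ∨ ∃ s t : S, s ≠ t ∧ m0 a b = m s t)
    (C : Type) [Group C] [Fintype C] (ρ : C →* Equiv.Perm T0)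
    (hρ : ∀ c s t, s ≠ t → m0 (ρ c s) (ρ c t) = m0 s t)
    (r : C) (ι : S → T0) (hι : Function.Injective ι)
    (hιm : ∀ s t, s ≠ t → m0 (ι s) (ι t) = m s t)
    (hr : ∀ s ∈ S', ρ r (ι (φ s)) = ι s) :
    ∃ (T : Type) (_ : Fintype T) (mT : T → T → ℕ∞),
      (∀ a b, mT a b = mT b a) ∧
      (∀ a b, a ≠ b → 2 ≤ mT a b) ∧
      (∀ a b, a ≠ b → mT a b = 2 ∨ mT a b = ⊤ ∨ ∃ s t : S, s ≠ t ∧ mT a b = m s t) ∧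
      ∃ H : Subgroup (ArtinHNN m S' φ), H.index ≠ 0 ∧
        ∃ ψ : H →* ArtinGroup mT, Function.Injective ψ := by
  classical
  let mT := extLab m0 ρ (ι '' S')
  refine ⟨T0 ⊕ C, inferInstance, mT, ?_, ?_, ?_, ?_⟩
  · rintro (a | a) (b | b)
    · exact hs0 a b
    · rfl
    · rfl
    · rfl
  · rintro (a | a) (b | b) hab
    · exact h20 a b (fun h => hab (by rw [h]))
    · change 2 ≤ (if ρ b⁻¹ a ∈ ι '' S' then (2 : ℕ∞) else ⊤)
      split_ifs <;> simp
    · change 2 ≤ (if ρ a⁻¹ b ∈ ι '' S' then (2 : ℕ∞) else ⊤)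
      split_ifs <;> simp
    · exact le_top
  · rintro (a | a) (b | b) hab
    · exact hlab a b (fun h => hab (by rw [h]))
    · change (if ρ b⁻¹ a ∈ ι '' S' then (2 : ℕ∞) else ⊤) = 2 ∨
        (if ρ b⁻¹ a ∈ ι '' S' then (2 : ℕ∞) else ⊤) = ⊤ ∨ _
      split_ifs <;> simp
    · change (if ρ a⁻¹ b ∈ ι '' S' then (2 : ℕ∞) else ⊤) = 2 ∨
        (if ρ a⁻¹ b ∈ ι '' S' then (2 : ℕ∞) else ⊤) = ⊤ ∨ _
      split_ifs <;> simp
    · exact Or.inr (Or.inl rfl)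
  -- the groups
  let θ0 := ArtinGroup.permAut ρ hρ
  let θ := ArtinGroup.permAut (extAct ρ) (extAct_lab hρ (ι '' S'))
  let P := ArtinGroup m0 ⋊[θ0] C
  let f : ArtinGroup m →* P := SemidirectProduct.inl.comp (ArtinGroup.map ι hι hιm)
  have hf : Function.Injective f :=
    SemidirectProduct.inl_injective.comp (vanDerLek hs0 h20 ι hι hιm)
  have hfgen : ∀ s, f (ArtinGroup.gen m s) = SemidirectProduct.inl (ArtinGroup.gen m0 (ι s)) := by
    intro s
    simp [f]
  let R : P := SemidirectProduct.inr r
  have hconj : ∀ c x, (SemidirectProduct.inr c : P) * SemidirectProduct.inl (ArtinGroup.gen m0 x) *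
      (SemidirectProduct.inr c : P)⁻¹ = SemidirectProduct.inl (ArtinGroup.gen m0 (ρ c x)) := by
    intro c x
    rw [← ArtinGroup.permAut_gen ρ hρ, SemidirectProduct.inl_aut, map_inv]
  have hRf : ∀ s ∈ S', R * f (ArtinGroup.gen m (φ s)) * R⁻¹ = f (ArtinGroup.gen m s) := by
    intro s hs
    rw [hfgen, hfgen, hconj, hr s hs]
  let A' : Subgroup (ArtinGroup m) := Subgroup.closure (ArtinGroup.gen m '' S')
  let A'' : Subgroup (ArtinGroup m) := Subgroup.closure ((fun s => ArtinGroup.gen m (φ s)) '' S')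
  let A2 : Subgroup P := A''.map f
  let cR : P ≃* P := MulAut.conj R
  let B2 : Subgroup P := A2.map cR.toMonoidHom
  let φ2 : A2 ≃* B2 := A2.equivMapOfInjective cR.toMonoidHom cR.injective
  have hφ2 : ∀ a : A2, (φ2 a : P) = R * a * R⁻¹ := fun a => rfl
  have hB2 : B2 = A'.map f := by
    simp only [B2, A2, A', A'', MonoidHom.map_closure, Set.image_image]
    congr 1
    apply Set.image_congr
    intro s hs
    exact hRf s hs
  have hA : ∀ g, f g ∈ A2 → g ∈ A'' := by
    rintro g ⟨g', hg', e⟩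
    rwa [← hf e]
  have hB : ∀ g, f g ∈ B2 → g ∈ A' := by
    rw [hB2]
    rintro g ⟨g', hg', e⟩
    rwa [← hf e]
  obtain ⟨φ1, hφ1⟩ : ∃ φ1 : A'' ≃* A', ∀ a, f (φ1 a) = R * f a * R⁻¹ := by
    let e1 := A''.equivMapOfInjective f hf
    let e2 := A'.equivMapOfInjective f hf
    let φ1 := (e1.trans φ2).trans ((MulEquiv.subgroupCongr hB2).trans e2.symm)
    refine ⟨φ1, fun a => ?_⟩
    have h1 : f (φ1 a) = (e2 (φ1 a) : P) := rfl
    rw [h1]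
    have h2 : e2 (φ1 a) = MulEquiv.subgroupCongr hB2 (φ2 (e1 a)) := by simp [φ1]
    rw [h2]
    rfl
  -- the HNN extensions
  let Q := HNNExtension P A2 B2 φ2
  let N1 := HNNExtension (ArtinGroup m) A'' A' φ1
  let J : N1 →* Q := HNNExtension.lift (HNNExtension.of.comp f) HNNExtension.t (by
    intro a
    have h := HNNExtension.t_mul_of (φ := φ2) (⟨f a, a, a.2, rfl⟩ : A2)
    change HNNExtension.t * HNNExtension.of (f a) = HNNExtension.of (f (φ1 a)) * HNNExtension.t
    rw [hφ1]
    exact h)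
  have hJ : Function.Injective J := by
    apply hnn_injective φ1 φ2 f hf hA hB J
    · intro g
      simp only [J, HNNExtension.lift_of, MonoidHom.comp_apply]
    · simp only [J, HNNExtension.lift_t]
  let G := ArtinHNN m S' φ
  let gs : S → G := fun s => PresentedGroup.of (Sum.inl s)
  let gt : G := PresentedGroup.of (Sum.inr ())
  let lam : ArtinGroup m →* G := ArtinGroup.lift gs (by
    intro s t n hst hn
    have := (altWord_rel_iff (PresentedGroup.mk (artinHNNRels m S' φ)) (Sum.inl s) (Sum.inl t) n).1
      (PresentedGroup.one_of_mem (Or.inl ⟨s, t, n, hst, hn, rfl⟩))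
    exact this)
  have hlam : ∀ s, lam (ArtinGroup.gen m s) = gs s := fun s => ArtinGroup.lift_gen _ _ _
  have hgt : ∀ s ∈ S', gt * gs (φ s) = gs s * gt := by
    intro s hs
    have h : PresentedGroup.mk (artinHNNRels m S' φ) ((FreeGroup.of (Sum.inr ()))⁻¹ *
        FreeGroup.of (Sum.inl s) * FreeGroup.of (Sum.inr ()) * (FreeGroup.of (Sum.inl (φ s)))⁻¹) = 1 :=
      PresentedGroup.one_of_mem (Or.inr ⟨s, hs, rfl⟩)
    have h' : gt⁻¹ * gs s * gt * (gs (φ s))⁻¹ = 1 := h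
    rw [mul_inv_eq_one, mul_assoc, inv_mul_eq_iff_eq_mul] at h'
    exact h'.symm
  let π : N1 →* G := HNNExtension.lift lam gt (by
    rintro ⟨a, ha⟩
    change gt * lam a = _
    induction ha using Subgroup.closure_induction with
    | mem x hx =>
      obtain ⟨s, hs, rfl⟩ := hx
      have e : ∀ hx, (φ1 ⟨ArtinGroup.gen m (φ s), hx⟩ : ArtinGroup m) = ArtinGroup.gen m s := by
        intro hx
        apply hf
        rw [hφ1, hRf s hs]
      change gt * lam (ArtinGroup.gen m (φ s)) = lam (φ1 ⟨ArtinGroup.gen m (φ s), _⟩) * gt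
      rw [e, hlam, hlam, hgt s hs]
    | one =>
      have : (φ1 ⟨1, A''.one_mem⟩ : ArtinGroup m) = 1 := by
        have : (⟨1, A''.one_mem⟩ : A'') = 1 := rfl
        rw [this, map_one]; rfl
      rw [this]; simp
    | mul x y hx hy ihx ihy =>
      have : (φ1 ⟨x * y, A''.mul_mem hx hy⟩ : ArtinGroup m) = φ1 ⟨x, hx⟩ * φ1 ⟨y, hy⟩ := by
        have : (⟨x * y, A''.mul_mem hx hy⟩ : A'') = ⟨x, hx⟩ * ⟨y, hy⟩ := rfl
        rw [this, map_mul]; rfl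
      rw [this, map_mul, map_mul, ← mul_assoc, ihx, mul_assoc, ihy, mul_assoc]
    | inv x hx ih =>
      have : (φ1 ⟨x⁻¹, A''.inv_mem hx⟩ : ArtinGroup m) = (φ1 ⟨x, hx⟩ : ArtinGroup m)⁻¹ := by
        have : (⟨x⁻¹, A''.inv_mem hx⟩ : A'') = ⟨x, hx⟩⁻¹ := rfl
        rw [this, map_inv]; rfl
      rw [this, map_inv, map_inv, eq_inv_mul_iff_mul_eq, ← mul_assoc, ← ih, mul_inv_cancel_right])
  have hπ1 : ∀ s, π (HNNExtension.of (ArtinGroup.gen m s)) = gs s := by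
    intro s
    exact (HNNExtension.lift_of _ _ _ _).trans (hlam s)
  have hπ2 : π HNNExtension.t = gt := HNNExtension.lift_t _ _ _
  have hπ : Function.Surjective π := by
    rw [← MonoidHom.range_eq_top, eq_top_iff]
    have : (⊤ : Subgroup G) = Subgroup.closure (Set.range (PresentedGroup.of)) :=
      (PresentedGroup.closure_range_of (artinHNNRels m S' φ)).symm
    refine this.le.trans ((Subgroup.closure_le _).2 ?_)
    rintro _ ⟨s | s, rfl⟩
    · exact ⟨_, hπ1 s⟩
    · exact ⟨_, hπ2⟩
  -- the target semidirect product
  let Y := ArtinGroup mT ⋊[θ] C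
  have hconjY : ∀ c x, (SemidirectProduct.inr c : Y) * SemidirectProduct.inl (ArtinGroup.gen mT x) *
      (SemidirectProduct.inr c : Y)⁻¹ =
      SemidirectProduct.inl (ArtinGroup.gen mT (extAct ρ c x)) := by
    intro c x
    rw [← ArtinGroup.permAut_gen (extAct ρ) (extAct_lab hρ (ι '' S')), SemidirectProduct.inl_aut,
      map_inv]
  let ys : S → Y := fun s => SemidirectProduct.inl (ArtinGroup.gen mT (Sum.inl (ι s)))
  let ye : Y := SemidirectProduct.inl (ArtinGroup.gen mT (Sum.inr 1))
  let yr : Y := SemidirectProduct.inr r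
  let Φ : G →* Y := PresentedGroup.toGroup (rels := artinHNNRels m S' φ)
    (f := Sum.elim ys (fun _ => ye * yr)) (by
      rintro w (⟨s, t, n, hst, hn, rfl⟩ | ⟨s, hs, rfl⟩)
      · rw [altWord_rel_iff]
        simp only [FreeGroup.lift_apply_of, Sum.elim_inl, ys]
        rw [← map_ralt, ← map_ralt]
        congr 1
        apply ArtinGroup.gen_rel
        · exact fun h => hst (hι (Sum.inl_injective h))
        · exact (hιm s t hst).trans hn
      · simp only [map_mul, map_inv, FreeGroup.lift_apply_of, Sum.elim_inl, Sum.elim_inr]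
        rw [mul_inv_eq_one, mul_assoc, inv_mul_eq_iff_eq_mul]
        have h1 : yr * ys (φ s) * yr⁻¹ = ys s := by
          simp only [yr, ys]
          rw [hconjY]
          change SemidirectProduct.inl (ArtinGroup.gen mT (Sum.inl (ρ r (ι (φ s))))) = _
          rw [hr s hs]
        have h2 : ys s * ye = ye * ys s := by
          simp only [ys, ye]
          rw [← map_mul, ← map_mul]
          congr 1
          apply comm_of_ralt_two
          apply ArtinGroup.gen_rel
          · simp
          · change (if ρ 1⁻¹ (ι s) ∈ ι '' S' then (2 : ℕ∞) else ⊤) = (2 : ℕ)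
            rw [if_pos]
            · rfl
            · simpa using ⟨s, hs, rfl⟩
        rw [← mul_assoc, h2, ← h1]
        exact group_aux1 _ _ _)
  have hΦs : ∀ s, Φ (gs s) = ys s := fun s => PresentedGroup.toGroup.of _
  have hΦt : Φ gt = ye * yr := PresentedGroup.toGroup.of _
  -- the retraction to Q
  let oQ : P →* Q := HNNExtension.of
  let tQ : Q := HNNExtension.t
  let fg : C →* Q := oQ.comp SemidirectProduct.inr
  let qx : T0 → Q := fun x => oQ (SemidirectProduct.inl (ArtinGroup.gen m0 x))
  let qe : C → Q := fun c => fg c * (tQ * (fg r)⁻¹) * (fg c)⁻¹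
  have hqx : ∀ c x, fg c * qx x * (fg c)⁻¹ = qx (ρ c x) := by
    intro c x
    simp only [qx]
    rw [← hconj c x]
    simp only [fg, map_mul, MonoidHom.comp_apply]
    rw [map_inv oQ]
  have hqe : ∀ c d, fg c * qe d * (fg c)⁻¹ = qe (c * d) := by
    intro c d
    simp only [qe]
    rw [map_mul]
    exact group_aux2 _ _ _
  have ht0 : ∀ s ∈ S', tQ * qx (ι (φ s)) = qx (ι s) * tQ := by
    intro s hs
    have hmem : f (ArtinGroup.gen m (φ s)) ∈ A2 :=
      ⟨_, Subgroup.subset_closure ⟨s, hs, rfl⟩, rfl⟩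
    have h := HNNExtension.t_mul_of (φ := φ2) (⟨_, hmem⟩ : A2)
    rw [hφ2] at h
    change tQ * oQ (f (ArtinGroup.gen m (φ s))) =
      oQ (R * f (ArtinGroup.gen m (φ s)) * R⁻¹) * tQ at h
    rw [hRf s hs, hfgen, hfgen] at h
    exact h
  have hcomm : ∀ s ∈ S', (tQ * (fg r)⁻¹) * qx (ι s) = qx (ι s) * (tQ * (fg r)⁻¹) := by
    intro s hs
    rw [← mul_assoc, ← ht0 s hs, ← hr s hs, ← hqx r (ι (φ s))]
    group
  have hcomm2 : ∀ c x, ρ c⁻¹ x ∈ ι '' S' → qe c * qx x = qx x * qe c := by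
    rintro c x ⟨s, hs, e⟩
    have hx : x = ρ c (ι s) := by rw [e]; simp
    rw [hx, ← hqx]
    have h := hcomm s hs
    simp only [qe]
    calc _ = fg c * ((tQ * (fg r)⁻¹) * qx (ι s)) * (fg c)⁻¹ := by group
      _ = _ := by rw [h]; group
  let fn : ArtinGroup mT →* Q := ArtinGroup.lift (Sum.elim qx qe) (by
    rintro (x | c) (y | d) n hst hn
    · simp only [Sum.elim_inl, qx]
      rw [← map_ralt, ← map_ralt, ← map_ralt, ← map_ralt]
      congr 2
      exact ArtinGroup.gen_rel (fun h => hst (by rw [h])) hn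
    · change (if ρ d⁻¹ x ∈ ι '' S' then (2 : ℕ∞) else ⊤) = n at hn
      split_ifs at hn with h
      · have : n = 2 := by exact_mod_cast hn.symm
        subst this
        exact ralt_two_of_comm (hcomm2 d x h).symm
      · exact absurd hn.symm (ENat.natCast_ne_top n)
    · change (if ρ c⁻¹ y ∈ ι '' S' then (2 : ℕ∞) else ⊤) = n at hn
      split_ifs at hn with h
      · have : n = 2 := by exact_mod_cast hn.symm
        subst this
        exact ralt_two_of_comm (hcomm2 c y h)
      · exact absurd hn.symm (ENat.natCast_ne_top n)
    · exact absurd hn.symm (ENat.natCast_ne_top n))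
  have hfn : ∀ a, fn (ArtinGroup.gen mT a) = Sum.elim qx qe a := fun a => ArtinGroup.lift_gen _ _ _
  let Θ : Y →* Q := SemidirectProduct.lift fn fg (by
    intro c
    apply ArtinGroup.hom_ext
    intro a
    change fn (θ c (ArtinGroup.gen mT a)) = fg c * fn (ArtinGroup.gen mT a) * (fg c)⁻¹
    have : θ c (ArtinGroup.gen mT a) = ArtinGroup.gen mT (extAct ρ c a) :=
      ArtinGroup.permAut_gen _ _ _ _
    rw [this, hfn, hfn]
    rcases a with x | d
    · exact (hqx c x).symm
    · exact (hqe c d).symm)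
  have hΘs : ∀ a, Θ (SemidirectProduct.inl (ArtinGroup.gen mT a)) = Sum.elim qx qe a := fun a =>
    (SemidirectProduct.lift_inl _ _ _ _).trans (hfn a)
  have hΘr : ∀ c, Θ (SemidirectProduct.inr c) = fg c := fun c =>
    SemidirectProduct.lift_inr _ _ _ _
  have hJs : ∀ g, J (HNNExtension.of g) = oQ (f g) := fun g => HNNExtension.lift_of _ _ _ _
  have hJt : J HNNExtension.t = tQ := HNNExtension.lift_t _ _ _
  have hcomp : ∀ z, Θ (Φ (π z)) = J z := by
    have : (Θ.comp Φ).comp π = J := by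
      apply HNNExtension.hom_ext
      · apply ArtinGroup.hom_ext
        intro s
        change Θ (Φ (π (HNNExtension.of (ArtinGroup.gen m s)))) = J (HNNExtension.of (ArtinGroup.gen m s))
        rw [hπ1, hΦs, hJs, hfgen]
        exact hΘs _
      · change Θ (Φ (π HNNExtension.t)) = J HNNExtension.t
        rw [hπ2, hΦt, map_mul, hJt]
        have e1 : Θ ye = qe 1 := hΘs _
        have e2 : Θ yr = fg r := hΘr _
        rw [e1, e2]
        simp only [qe]
        rw [map_one fg]
        exact group_aux3 _ _
    intro z
    rw [← this]; rfl
  have hΦ : Function.Injective Φ := by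
    rw [injective_iff_map_eq_one]
    intro g hg
    obtain ⟨z, rfl⟩ := hπ g
    have h := hcomp z
    rw [hg, map_one] at h
    have : z = 1 := hJ (by rw [← h, map_one])
    rw [this, map_one]
  -- the finite-index subgroup
  let K : G →* C := SemidirectProduct.rightHom.comp Φ
  have hK : ∀ x : K.ker, (Φ x).right = 1 := fun x => x.2
  refine ⟨K.ker, ?_, ⟨⟨fun x => (Φ x).left, ?_⟩, ?_⟩, ?_⟩
  · rw [Subgroup.index_ker]
    exact Nat.card_pos.ne'
  · simp
  · intro x y
    change (Φ ((x : G) * (y : G))).left = _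
    rw [map_mul]
    refine (SemidirectProduct.mul_left _ _).trans ?_
    rw [hK x, map_one]
    rfl
  · intro x y hxy
    apply Subtype.ext
    apply hΦ
    exact SemidirectProduct.ext hxy ((hK x).trans (hK y).symm)


/-! ### Extending the partial symmetry -/

section EPPA

variable {S : Type} (m : S → S → ℕ∞)

open Classical in
/-- Encoding of labels. -/
noncomputable def enc (l : ℕ∞) : S × S → ZMod 3 := fun p =>
  if p.1 ≠ p.2 ∧ m p.1 p.2 = l then 1 else 0

open Classical in
/-- Decoding of labels. -/
noncomputable def dec (v : S × S → ZMod 3) : ℕ∞ :=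
  if h : ∃ p : S × S, p.1 ≠ p.2 ∧ v = enc m (m p.1 p.2) then m h.choose.1 h.choose.2 else ⊤

theorem dec_enc {s t : S} (hst : s ≠ t) : dec m (enc m (m s t)) = m s t := by
  classical
  have h : ∃ p : S × S, p.1 ≠ p.2 ∧ enc m (m s t) = enc m (m p.1 p.2) := ⟨(s, t), hst, rfl⟩
  rw [dec, dif_pos h]
  have h2 := congrFun h.choose_spec.2 (s, t)
  by_contra hne
  rw [enc, enc, if_pos ⟨hst, rfl⟩, if_neg (fun hh => hne hh.2.symm)] at h2
  exact absurd h2 (by decide)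

theorem dec_cases (v : S × S → ZMod 3) :
    dec m v = ⊤ ∨ ∃ s t : S, s ≠ t ∧ dec m v = m s t := by
  classical
  by_cases h : ∃ p : S × S, p.1 ≠ p.2 ∧ v = enc m (m p.1 p.2)
  · right
    exact ⟨h.choose.1, h.choose.2, h.choose_spec.1, by rw [dec, dif_pos h]⟩
  · left
    rw [dec, dif_neg h]

open Classical in
/-- Labels of the enlarged system. -/
noncomputable def bigLab (x y : S × (S → (S × S → ZMod 3))) : ℕ∞ :=
  if x.1 = y.1 then ⊤ else dec m (x.2 y.1 + y.2 x.1)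

/-- The embedding into the enlarged system. -/
noncomputable def bigEmb (s : S) : S × (S → (S × S → ZMod 3)) := (s, fun u => -enc m (m s u))

/-- The permutation of the enlarged system given by a permutation and a correction. -/
def bigPerm (σ : Equiv.Perm S) (c : S → S → (S × S → ZMod 3)) :
    Equiv.Perm (S × (S → (S × S → ZMod 3))) where
  toFun x := (σ x.1, fun u => x.2 (σ.symm u) + c x.1 (σ.symm u))
  invFun x := (σ.symm x.1, fun u => x.2 (σ u) - c (σ.symm x.1) u)
  left_inv x := by simp
  right_inv x := by simp

end EPPA


/-- Every Artin HNN-extension G(S, m, φ) contains a finite-index subgroup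
that embeds into an Artin group whose set of labels is contained in L(S,m) ∪ {2, ∞}. -/
theorem artin_hnn_virtually_embeds
    (S : Type) [Fintype S]
    (m : S → S → ℕ∞)
    (hsymm : ∀ s t, m s t = m t s)
    (h2 : ∀ s t, s ≠ t → 2 ≤ m s t)
    (S' S'' : Set S) (φ : S → S)
    (hmap : ∀ s ∈ S', φ s ∈ S'')
    (hinj : Set.InjOn φ S')
    (hsurj : S'' ⊆ φ '' S')
    (hpres : ∀ s ∈ S', ∀ t ∈ S', m s t = m (φ s) (φ t)) :
    ∃ (T : Type) (_ : Fintype T) (mT : T → T → ℕ∞),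
      (∀ a b, mT a b = mT b a) ∧
      (∀ a b, a ≠ b → 2 ≤ mT a b) ∧
      -- the labels of (T, mT) lie in L(S,m) ∪ {2, ∞}
      (∀ a b, a ≠ b → mT a b = 2 ∨ mT a b = ⊤ ∨ ∃ s t : S, s ≠ t ∧ mT a b = m s t) ∧
      ∃ H : Subgroup (ArtinHNN m S' φ), H.index ≠ 0 ∧
        ∃ ψ : H →* ArtinGroup mT, Function.Injective ψ := by

  classical
  let e : S' ≃ (φ '' S' : Set S) := Equiv.Set.imageOfInjOn φ S' hinj
  let σ : Equiv.Perm S := Equiv.extendSubtype (p := fun x => x ∈ S') (q := fun x => x ∈ φ '' S') e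
  have hσ : ∀ s ∈ S', σ s = φ s := fun s hs =>
    Equiv.extendSubtype_apply_of_mem (p := fun x => x ∈ S') (q := fun x => x ∈ φ '' S') e s hs
  let δ : S → S → (S × S → ZMod 3) := fun s u => enc m (m s u) - enc m (m (σ s) (σ u))
  have hδs : ∀ s u, δ s u = δ u s := by
    intro s u
    simp only [δ, hsymm s u, hsymm (σ s) (σ u)]
  have hδ0 : ∀ s ∈ S', ∀ u ∈ S', δ s u = 0 := by
    intro s hs u hu
    simp only [δ, hσ s hs, hσ u hu, hpres s hs u hu, sub_self]
  let c : S → S → (S × S → ZMod 3) := fun s u =>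
    if s ∈ S' then δ s u else if u ∈ S' then -δ s u else 0
  have hc : ∀ s u, c s u + c u s = 0 := by
    intro s u
    simp only [c]
    by_cases hs : s ∈ S' <;> by_cases hu : u ∈ S'
    · simp [hs, hu, hδ0]
    · simp [hs, hu, hδs s u]
    · simp [hs, hu, hδs s u]
    · simp [hs, hu]
  let τ := bigPerm σ c
  have hτ : ∀ x y, bigLab m (τ x) (τ y) = bigLab m x y := by
    intro x y
    have h1 : (τ x).1 = σ x.1 := rfl
    have h2 : (τ y).1 = σ y.1 := rfl
    have h3 : (τ x).2 (σ y.1) + (τ y).2 (σ x.1) = x.2 y.1 + y.2 x.1 := by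
      change (x.2 (σ.symm (σ y.1)) + c x.1 (σ.symm (σ y.1))) +
        (y.2 (σ.symm (σ x.1)) + c y.1 (σ.symm (σ x.1))) = _
      simp only [Equiv.symm_apply_apply]
      have := hc x.1 y.1
      calc _ = x.2 y.1 + y.2 x.1 + (c x.1 y.1 + c y.1 x.1) := by abel
        _ = _ := by rw [this, add_zero]
    rw [bigLab, bigLab, h1, h2, h3]
    simp only [σ.injective.eq_iff]
  have hτι : ∀ s ∈ S', τ (bigEmb m s) = bigEmb m (φ s) := by
    intro s hs
    refine Prod.ext (hσ s hs) ?_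
    funext u
    change -enc m (m s (σ.symm u)) + c s (σ.symm u) = -enc m (m (φ s) u)
    simp only [c, if_pos hs, δ, Equiv.apply_symm_apply, hσ s hs]
    abel
  let C : Subgroup (Equiv.Perm (S × (S → (S × S → ZMod 3)))) :=
    { carrier := {p | ∀ x y, bigLab m (p x) (p y) = bigLab m x y}
      one_mem' := fun x y => rfl
      mul_mem' := fun {a b} ha hb x y => (ha _ _).trans (hb x y)
      inv_mem' := fun {a} ha x y => by
        have := ha (a⁻¹ x) (a⁻¹ y)
        simpa using this.symm }
  haveI : Fintype C := Fintype.ofFinite C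
  refine core S m S' φ (S × (S → (S × S → ZMod 3))) (bigLab m) ?_ ?_ ?_ C C.subtype ?_
    (⟨τ, hτ⟩ : C)⁻¹ (bigEmb m) ?_ ?_ ?_
  · intro x y
    simp only [bigLab, eq_comm (a := x.1), add_comm (x.2 y.1)]
  · intro x y _
    rw [bigLab]
    split_ifs
    · exact le_top
    · rcases dec_cases m (x.2 y.1 + y.2 x.1) with h | ⟨s, t, hst, h⟩
      · rw [h]; exact le_top
      · rw [h]; exact h2 s t hst
  · intro x y _
    right
    rw [bigLab]
    split_ifs
    · exact Or.inl rfl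
    · exact dec_cases m _
  · intro p x y _
    exact p.2 x y
  · intro s t h
    exact congrArg Prod.fst h
  · intro s t hst
    have : (bigEmb m s).2 t + (bigEmb m t).2 s = enc m (m s t) := by
      change -enc m (m s t) + -enc m (m t s) = _
      rw [hsymm t s]
      funext p
      change -enc m (m s t) p + -enc m (m s t) p = enc m (m s t) p
      generalize enc m (m s t) p = z
      revert z
      decide
    have h1 : (bigEmb m s).1 = s := rfl
    have h2 : (bigEmb m t).1 = t := rfl
    rw [bigLab, h1, h2, if_neg hst, this, dec_enc m hst]
  · intro s hs
    change τ⁻¹ (bigEmb m (φ s)) = bigEmb m s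
    rw [Equiv.Perm.inv_eq_iff_eq, hτι s hs]
end

section
/- Every right-angled Artin HNN-extension contains a finite-index subgroup that embeds in a right-angled Artin group. -/
open SimpleGraph

namespace RaagHNN

/-! ### Right-angled Artin groups of graphs -/

open Classical in
/-- The right-angled label function of a graph. -/
noncomputable def gm {V : Type} (Γ : SimpleGraph V) (a b : V) : ℕ∞ :=
  if Γ.Adj a b then 2 else ⊤

/-- The right-angled Artin group of a graph. -/
abbrev R {V : Type} (Γ : SimpleGraph V) := ArtinGroup (gm Γ)

/-- The standard generators. -/
def gen {V : Type} (Γ : SimpleGraph V) (v : V) : R Γ := PresentedGroup.of (rels := artinRels (gm Γ)) v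

theorem altWord_two {α : Type*} (s t : α) :
    altWord s t 2 = FreeGroup.of s * FreeGroup.of t := by
  simp [altWord, List.range_succ]

theorem gm_eq_coe {V : Type} {Γ : SimpleGraph V} {a b : V} {n : ℕ}
    (h : gm Γ a b = (n : ℕ∞)) : Γ.Adj a b ∧ n = 2 := by
  unfold gm at h
  split_ifs at h with h1
  · exact ⟨h1, by exact_mod_cast h.symm⟩
  · exact absurd h.symm (ENat.natCast_ne_top n)

theorem gen_comm {V : Type} {Γ : SimpleGraph V} {a b : V} (h : Γ.Adj a b) :
    gen Γ a * gen Γ b = gen Γ b * gen Γ a := by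
  have h1 : (altWord a b 2 * (altWord b a 2)⁻¹) ∈ artinRels (gm Γ) :=
    ⟨a, b, 2, h.ne, by simp [gm, h], rfl⟩
  have h2 := PresentedGroup.one_of_mem h1
  rw [altWord_two, altWord_two, map_mul, map_inv, map_mul, map_mul, mul_inv_eq_one] at h2
  exact h2

/-- Universal property of the RAAG. -/
def rlift {V : Type} {Γ : SimpleGraph V} {H : Type*} [Group H] (f : V → H)
    (hf : ∀ a b, Γ.Adj a b → f a * f b = f b * f a) : R Γ →* H :=
  PresentedGroup.toGroup (rels := artinRels (gm Γ)) (f := f) (by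
    rintro r ⟨s, t, n, hst, hm, rfl⟩
    obtain ⟨ha, rfl⟩ := gm_eq_coe hm
    simp only [altWord_two, map_mul, map_inv, FreeGroup.lift_apply_of]
    rw [mul_inv_eq_one, hf _ _ ha])

@[simp] theorem rlift_gen {V : Type} {Γ : SimpleGraph V} {H : Type*} [Group H] (f : V → H)
    (hf : ∀ a b, Γ.Adj a b → f a * f b = f b * f a) (v : V) : rlift f hf (gen Γ v) = f v :=
  PresentedGroup.toGroup.of _

theorem rext {V : Type} {Γ : SimpleGraph V} {H : Type*} [Group H] {f g : R Γ →* H}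
    (h : ∀ v, f (gen Γ v) = g (gen Γ v)) : f = g :=
  PresentedGroup.ext (rels := artinRels (gm Γ)) h

/-- Functoriality. -/
noncomputable def rmap {V W : Type} {Γ : SimpleGraph V} {Δ : SimpleGraph W} (f : V → W)
    (hf : ∀ a b, Γ.Adj a b → Δ.Adj (f a) (f b)) : R Γ →* R Δ :=
  rlift (fun v => gen Δ (f v)) (fun a b h => gen_comm (hf a b h))

@[simp] theorem rmap_gen {V W : Type} {Γ : SimpleGraph V} {Δ : SimpleGraph W} (f : V → W)
    (hf : ∀ a b, Γ.Adj a b → Δ.Adj (f a) (f b)) (v : V) :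
    rmap f hf (gen Γ v) = gen Δ (f v) := rlift_gen _ _ _

open Classical in
theorem rmap_injective {V W : Type} {Γ : SimpleGraph V} {Δ : SimpleGraph W} (f : V → W)
    (hinj : Function.Injective f)
    (hf : ∀ a b, Γ.Adj a b ↔ Δ.Adj (f a) (f b)) :
    Function.Injective (rmap f (fun a b => (hf a b).1) : R Γ →* R Δ) := by
  let ρ : R Δ →* R Γ := rlift
    (fun w => if h : ∃ v, f v = w then gen Γ h.choose else 1) (by
      intro a b hab
      by_cases ha : ∃ v, f v = a
      · by_cases hb : ∃ v, f v = b
        · simp only [ha, hb, dif_pos]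
          apply gen_comm
          rw [hf, ha.choose_spec, hb.choose_spec]
          exact hab
        · simp [hb]
      · simp [ha])
  have : ρ.comp (rmap f (fun a b => (hf a b).1)) = MonoidHom.id _ := by
    apply rext
    intro v
    have h : ∃ v', f v' = f v := ⟨v, rfl⟩
    simp only [MonoidHom.comp_apply, rmap_gen, ρ, rlift_gen, MonoidHom.id_apply]
    rw [dif_pos h, hinj h.choose_spec]
  intro x y hxy
  have h2 := congrArg ρ hxy
  rw [← MonoidHom.comp_apply, ← MonoidHom.comp_apply, this] at h2
  exact h2

/-- Automorphisms of the graph act on the RAAG. -/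
noncomputable def ract {V : Type} {Γ : SimpleGraph V} {Q : Type} [Group Q] (ρ : Q →* (Γ ≃g Γ)) :
    Q →* MulAut (R Γ) where
  toFun q := MonoidHom.toMulEquiv (rmap (ρ q) (fun _ _ h => (ρ q).map_rel_iff.2 h))
    (rmap (ρ q⁻¹) (fun _ _ h => (ρ q⁻¹).map_rel_iff.2 h))
    (rext fun v => by
      simp only [MonoidHom.comp_apply, rmap_gen, MonoidHom.id_apply]
      rw [← RelIso.mul_apply, ← map_mul]; simp)
    (rext fun v => by
      simp only [MonoidHom.comp_apply, rmap_gen, MonoidHom.id_apply]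
      rw [← RelIso.mul_apply, ← map_mul]; simp)
  map_one' := by
    apply MulEquiv.toMonoidHom_injective
    apply rext
    intro v
    simp
  map_mul' a b := by
    apply MulEquiv.toMonoidHom_injective
    apply rext
    intro v
    simp

@[simp] theorem ract_gen {V : Type} {Γ : SimpleGraph V} {Q : Type} [Group Q]
    (ρ : Q →* (Γ ≃g Γ)) (q : Q) (v : V) : ract ρ q (gen Γ v) = gen Γ (ρ q v) :=
  rmap_gen _ (fun _ _ h => (ρ q).map_rel_iff.2 h) _

/-! ### HNN extensions -/

/-- The isomorphism between the two associated subgroups. -/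
noncomputable def hequiv {C A : Type} [Group C] [Group A] (α β : C →* A)
    (hα : Function.Injective α) (hβ : Function.Injective β) : α.range ≃* β.range :=
  (MonoidHom.ofInjective hα).symm.trans (MonoidHom.ofInjective hβ)

theorem hequiv_apply {C A : Type} [Group C] [Group A] (α β : C →* A)
    (hα : Function.Injective α) (hβ : Function.Injective β) (c : C) :
    ((hequiv α β hα hβ ⟨α c, c, rfl⟩ : β.range) : A) = β c := by
  have : (⟨α c, c, rfl⟩ : α.range) = MonoidHom.ofInjective hα c := rfl
  rw [this]
  simp only [hequiv, MulEquiv.trans_apply, MulEquiv.symm_apply_apply]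
  rfl

/-- HNN extension with associated subgroups the images of two injections. -/
abbrev HN {C A : Type} [Group C] [Group A] (α β : C →* A)
    (hα : Function.Injective α) (hβ : Function.Injective β) :=
  HNNExtension A α.range β.range (hequiv α β hα hβ)

theorem hn_rel {C A : Type} [Group C] [Group A] (α β : C →* A)
    (hα : Function.Injective α) (hβ : Function.Injective β) (c : C) :
    (HNNExtension.t * HNNExtension.of (α c) : HN α β hα hβ) =
      HNNExtension.of (β c) * HNNExtension.t := by
  have := HNNExtension.t_mul_of (φ := hequiv α β hα hβ) ⟨α c, c, rfl⟩
  rw [hequiv_apply] at this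
  exact this

/-- Universal property. -/
noncomputable def hnlift {C A : Type} [Group C] [Group A] (α β : C →* A)
    (hα : Function.Injective α) (hβ : Function.Injective β) {H : Type*} [Group H]
    (f : A →* H) (x : H) (hx : ∀ c, x * f (α c) = f (β c) * x) : HN α β hα hβ →* H :=
  HNNExtension.lift f x (by
    rintro ⟨_, c, rfl⟩
    rw [hequiv_apply]
    exact hx c)

theorem hn_exists_word {A : Type} [Group A] {B B' : Subgroup A} (φ : B ≃* B')
    (x : HNNExtension A B B' φ) :
    ∃ w : HNNExtension.NormalWord.ReducedWord A B B', w.prod φ = x := by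
  rcases HNNExtension.NormalWord.TransversalPair.nonempty A B B' with ⟨d⟩
  refine ⟨((HNNExtension.NormalWord.equiv φ d) x).toReducedWord, ?_⟩
  exact (HNNExtension.NormalWord.equiv φ d).symm_apply_apply x

theorem hn_map_injective {C A A' : Type} [Group C] [Group A] [Group A'] (α β : C →* A)
    (hα : Function.Injective α) (hβ : Function.Injective β) (ι : A →* A')
    (hι : Function.Injective ι)
    (hα' : Function.Injective (ι.comp α)) (hβ' : Function.Injective (ι.comp β))
    (F : HN α β hα hβ →* HN (ι.comp α) (ι.comp β) hα' hβ')
    (hof : ∀ a, F (HNNExtension.of a) = HNNExtension.of (ι a))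
    (ht : F HNNExtension.t = HNNExtension.t) : Function.Injective F := by
  rw [injective_iff_map_eq_one]
  intro x hx
  obtain ⟨w, rfl⟩ := hn_exists_word _ x
  let w' : HNNExtension.NormalWord.ReducedWord A' (ι.comp α).range (ι.comp β).range :=
    { head := ι w.head
      toList := w.toList.map (fun p => (p.1, ι p.2))
      chain := by
        rw [List.isChain_map]
        refine w.chain.imp ?_
        rintro ⟨u, a⟩ ⟨v, b⟩ h h'
        apply h
        rcases Int.units_eq_one_or u with rfl | rfl
        · obtain ⟨c, hc⟩ := h'
          exact ⟨c, hι hc⟩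
        · obtain ⟨c, hc⟩ := h'
          exact ⟨c, hι hc⟩ }
  have hw' : F (w.prod _) = w'.prod _ := by
    simp [HNNExtension.NormalWord.ReducedWord.prod, w', hof, ht, map_list_prod, Function.comp_def]
  have hnil := HNNExtension.ReducedWord.toList_eq_nil_of_mem_of_range _ w'
    ⟨1, by rw [← hw', hx, map_one]⟩
  have hnil' : w.toList = [] := by simpa [w'] using hnil
  have hp : w.prod (hequiv α β hα hβ) = HNNExtension.of w.head := by
    simp [HNNExtension.NormalWord.ReducedWord.prod, hnil']
  rw [hp] at hx ⊢
  rw [hof, ← map_one HNNExtension.of] at hx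
  have := HNNExtension.of_injective _ hx
  rw [← map_one ι] at this
  rw [hι this, map_one]

/-! ### Extending one partial automorphism of a finite graph -/

theorem eppa {S : Type} [Fintype S] (Γ : SimpleGraph S) (S' : Set S) (φ : S → S)
    (hinj : Set.InjOn φ S')
    (hpres : ∀ s ∈ S', ∀ t ∈ S', Γ.Adj s t ↔ Γ.Adj (φ s) (φ t)) :
    ∃ (V : Type) (_ : Finite V) (Δ : SimpleGraph V) (i : S → V) (σ : Δ ≃g Δ),
      Function.Injective i ∧ (∀ a b, Γ.Adj a b ↔ Δ.Adj (i a) (i b)) ∧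
      ∀ s ∈ S', σ (i s) = i (φ s) := by
  classical
  let π : Equiv.Perm S := (Equiv.Set.imageOfInjOn φ S' hinj).extendSubtype
  have hπ : ∀ s ∈ S', π s = φ s := fun s hs =>
    Equiv.extendSubtype_apply_of_mem _ s hs
  let e := Fintype.equivFin S
  let χ : S → S → Bool := fun v w => decide (Γ.Adj v w ∧ e w < e v)
  have hχ : ∀ v w, v ≠ w → (Γ.Adj v w ↔ χ v w ≠ χ w v) := by
    intro v w hvw
    have h1 : e v ≠ e w := fun h => hvw (e.injective h)
    by_cases ha : Γ.Adj v w
    · rcases lt_or_gt_of_ne h1 with h | h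
      · simp [χ, ha, ha.symm, h, h.not_gt]
      · simp [χ, ha, ha.symm, h, h.not_gt]
    · have ha' : ¬ Γ.Adj w v := fun h => ha h.symm
      simp [χ, ha, ha']
  let F : S → S → Bool := fun v w =>
    if v ∈ S' then xor (χ v w) (χ (π v) (π w))
    else if w ∈ S' then xor (χ w v) (χ (π w) (π v)) else false
  have hF : ∀ v w, F v w = F w v := by
    intro v w
    by_cases hvw : v = w
    · subst hvw; rfl
    by_cases hv : v ∈ S' <;> by_cases hw : w ∈ S' <;> simp only [F, hv, hw, if_true, if_false]
    have h1 := hχ v w hvw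
    have h2 := hχ (π v) (π w) (fun h => hvw (π.injective h))
    have h3 := hpres v hv w hw
    rw [← hπ v hv, ← hπ w hw] at h3
    rw [h1, h2] at h3
    revert h3
    generalize χ v w = a
    generalize χ w v = b
    generalize χ (π v) (π w) = c
    generalize χ (π w) (π v) = d
    revert a b c d
    decide
  let Δ : SimpleGraph (S × (S → Bool)) :=
    { Adj := fun p q => p.1 ≠ q.1 ∧ p.2 q.1 ≠ q.2 p.1
      symm := ⟨fun p q h => ⟨h.1.symm, h.2.symm⟩⟩
      loopless := ⟨fun p h => h.1 rfl⟩ }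
  let σ : Δ ≃g Δ :=
    { toFun := fun p => (π p.1, fun w => xor (p.2 (π.symm w)) (F p.1 (π.symm w)))
      invFun := fun p => (π.symm p.1, fun w => xor (p.2 (π w)) (F (π.symm p.1) w))
      left_inv := by rintro ⟨v, x⟩; simp
      right_inv := by rintro ⟨v, x⟩; simp
      map_rel_iff' := by
        rintro ⟨v, x⟩ ⟨w, y⟩
        simp [Δ, hF v w] }
  refine ⟨S × (S → Bool), inferInstance, Δ, fun v => (v, χ v), σ, ?_, ?_, ?_⟩
  · intro a b h
    exact (Prod.ext_iff.1 h).1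
  · intro a b
    constructor
    · intro h
      exact ⟨h.ne, (hχ a b h.ne).1 h⟩
    · rintro ⟨h1, h2⟩
      exact (hχ a b h1).2 h2
  · intro s hs
    have : ∀ w, xor (χ s w) (F s w) = χ (π s) (π w) := by
      intro w
      simp [F, hs]
    refine Prod.ext (hπ s hs) ?_
    funext w
    change xor (χ s (π.symm w)) (F s (π.symm w)) = χ (φ s) w
    rw [this, hπ s hs]
    simp

/-! ### The target graph -/

/-- The graph obtained from `Δ` by adding, for each automorphism `g`, a vertex adjacent to the
translate by `g` of the set `X`. -/
def lam {V : Type} (Δ : SimpleGraph V) (X : Set V) : SimpleGraph (V ⊕ (Δ ≃g Δ)) where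
  Adj := fun p q => match p, q with
    | Sum.inl a, Sum.inl b => Δ.Adj a b
    | Sum.inl a, Sum.inr g => g⁻¹ a ∈ X
    | Sum.inr g, Sum.inl a => g⁻¹ a ∈ X
    | Sum.inr _, Sum.inr _ => False
  symm := ⟨by
    rintro (a | g) (b | h) hh
    · exact Δ.adj_symm hh
    · exact hh
    · exact hh
    · exact hh⟩
  loopless := ⟨by
    rintro (a | g) hh
    · exact Δ.loopless.irrefl a hh
    · exact hh⟩

/-- The action of the automorphisms of `Δ` on `lam Δ X`. -/
def lamAct {V : Type} (Δ : SimpleGraph V) (X : Set V) :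
    (Δ ≃g Δ) →* (lam Δ X ≃g lam Δ X) where
  toFun g :=
    { toEquiv := Equiv.sumCongr g.toEquiv (Equiv.mulLeft g)
      map_rel_iff' := by
        rintro (a | h) (b | k)
        · exact g.map_rel_iff
        · change (g * k)⁻¹ (g a) ∈ X ↔ k⁻¹ a ∈ X
          simp
        · change (g * h)⁻¹ (g b) ∈ X ↔ h⁻¹ b ∈ X
          simp
        · exact Iff.rfl }
  map_one' := by
    ext (a | h)
    · rfl
    · exact congrArg Sum.inr (one_mul h)
  map_mul' g g' := by
    ext (a | h)
    · rfl
    · exact congrArg Sum.inr (mul_assoc g g' h)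

@[simp] theorem lamAct_inl {V : Type} (Δ : SimpleGraph V) (X : Set V) (g : Δ ≃g Δ) (v : V) :
    lamAct Δ X g (Sum.inl v) = Sum.inl (g v) := rfl

@[simp] theorem lamAct_inr {V : Type} (Δ : SimpleGraph V) (X : Set V) (g h : Δ ≃g Δ) :
    lamAct Δ X g (Sum.inr h) = Sum.inr (g * h) := rfl

theorem core {S V : Type} {Γ : SimpleGraph S} {Δ : SimpleGraph V} {S' : Set S} {φ : S → S}
    (α β : R (Γ.comap (Subtype.val : S' → S)) →* R Γ)
    (hα : Function.Injective α) (hβ : Function.Injective β)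
    (hαg : ∀ s : S', α (gen _ s) = gen Γ (φ s)) (hβg : ∀ s : S', β (gen _ s) = gen Γ s)
    (i : S → V) (σ : Δ ≃g Δ) (hi : Function.Injective i)
    (hadj : ∀ a b, Γ.Adj a b ↔ Δ.Adj (i a) (i b))
    (hσ : ∀ s ∈ S', σ (i s) = i (φ s)) :
    ∃ F : HN α β hα hβ →*
      (R (lam Δ (Set.image (fun s => i (φ s)) S')) ⋊[ract (lamAct Δ (Set.image (fun s => i (φ s)) S'))] (Δ ≃g Δ)),
      Function.Injective F := by
  set X := Set.image (fun s => i (φ s)) S' with hX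
  let ι₀ : R Γ →* R Δ := rmap i (fun a b => (hadj a b).1)
  have hι₀ : Function.Injective ι₀ := rmap_injective i hi hadj
  let ι : R Γ →* (R Δ ⋊[ract (MonoidHom.id (Δ ≃g Δ))] (Δ ≃g Δ)) := SemidirectProduct.inl.comp ι₀
  have hι : Function.Injective ι := SemidirectProduct.inl_injective.comp hι₀
  have hιg : ∀ s, ι (gen Γ s) = SemidirectProduct.inl (gen Δ (i s)) := by
    intro s; simp [ι, ι₀]
  have hα' : Function.Injective (ι.comp α) := hι.comp hα
  have hβ' : Function.Injective (ι.comp β) := hι.comp hβ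
  -- the canonical map
  let E : HN α β hα hβ →* HN (ι.comp α) (ι.comp β) hα' hβ' :=
    hnlift α β hα hβ (HNNExtension.of.comp ι) HNNExtension.t
      (fun c => hn_rel (ι.comp α) (ι.comp β) hα' hβ' c)
  have hE : Function.Injective E :=
    hn_map_injective α β hα hβ ι hι hα' hβ' E (fun a => HNNExtension.lift_of _ _ _ _)
      (HNNExtension.lift_t _ _ _)
  -- the map to the virtual RAAG
  let j : R Γ →* R (lam Δ X) := rmap (fun s => Sum.inl (i s)) (fun a b => (hadj a b).1)
  have hjg : ∀ s, j (gen Γ s) = gen _ (Sum.inl (i s)) := fun s => rmap_gen _ _ _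
  let tt : R (lam Δ X) ⋊[ract (lamAct Δ X)] (Δ ≃g Δ) :=
    (SemidirectProduct.inr σ)⁻¹ * SemidirectProduct.inl (gen _ (Sum.inr 1))
  let inlj := (SemidirectProduct.inl (φ := ract (lamAct Δ X))).comp j
  have hrel : ∀ c, tt * inlj (α c) = inlj (β c) * tt := by
    have : inlj.comp α = (MulAut.conj tt⁻¹).toMonoidHom.comp (inlj.comp β) := by
      apply rext
      intro s
      have h1 : (SemidirectProduct.inr σ * SemidirectProduct.inl (gen _ (Sum.inl (i s))) *
          (SemidirectProduct.inr σ)⁻¹ : R (lam Δ X) ⋊[ract (lamAct Δ X)] (Δ ≃g Δ)) =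
          SemidirectProduct.inl (gen _ (Sum.inl (i (φ s)))) := by
        rw [← map_inv, ← SemidirectProduct.inl_aut, ract_gen, lamAct_inl, hσ s s.2]
      have h2 : gen (lam Δ X) (Sum.inl (i (φ s))) * gen (lam Δ X) (Sum.inr 1) =
          gen (lam Δ X) (Sum.inr 1) * gen (lam Δ X) (Sum.inl (i (φ s))) := by
        apply gen_comm
        change (1 : Δ ≃g Δ)⁻¹ (i (φ s)) ∈ X
        exact ⟨s, s.2, by simp⟩
      have h3 := congrArg (SemidirectProduct.inl (φ := ract (lamAct Δ X))) h2
      rw [map_mul, map_mul] at h3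
      simp only [MonoidHom.comp_apply, hαg, hβg, inlj, hjg, MulEquiv.coe_toMonoidHom,
        MulAut.conj_apply, tt, mul_inv_rev, inv_inv]
      rw [← h1] at h3 ⊢
      rw [eq_comm]
      simp only [mul_assoc] at h3 ⊢
      rw [h3]
      simp
    intro c
    have h := DFunLike.congr_fun this c
    simp only [MonoidHom.comp_apply, MulEquiv.coe_toMonoidHom, MulAut.conj_apply] at h
    rw [h]
    simp only [inv_inv, mul_assoc, mul_inv_cancel_left]
  let F := hnlift α β hα hβ inlj tt hrel
  refine ⟨F, ?_⟩
  -- the comparison map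
  let K := HN (ι.comp α) (ι.comp β) hα' hβ'
  let fg : (Δ ≃g Δ) →* K := HNNExtension.of.comp SemidirectProduct.inr
  let fd : R Δ →* K := HNNExtension.of.comp SemidirectProduct.inl
  have hconj : ∀ (g : Δ ≃g Δ) v, fg g * fd (gen Δ v) * (fg g)⁻¹ = fd (gen Δ (g v)) := by
    intro g v
    simp only [fg, fd, MonoidHom.comp_apply]
    rw [← map_inv, ← map_inv, ← map_mul, ← map_mul, ← SemidirectProduct.inl_aut, ract_gen]
    rfl
  let r : K := fg σ * HNNExtension.t
  have hr : ∀ x ∈ X, fd (gen Δ x) * r = r * fd (gen Δ x) := by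
    rintro _ ⟨s, hs, rfl⟩
    have h1 := hn_rel (ι.comp α) (ι.comp β) hα' hβ' (gen _ ⟨s, hs⟩)
    simp only [MonoidHom.comp_apply, hαg, hβg, hιg] at h1
    change HNNExtension.t * fd (gen Δ (i (φ s))) = fd (gen Δ (i s)) * HNNExtension.t at h1
    have h2 := hconj σ (i s)
    rw [hσ s hs] at h2
    simp only [r]
    rw [mul_assoc, h1, ← h2]
    group
  let fn : R (lam Δ X) →* K := rlift
    (Sum.elim (fun v => fd (gen Δ v)) (fun g => fg g * r * (fg g)⁻¹)) (by
      have key : ∀ (a : V) (g : Δ ≃g Δ), g⁻¹ a ∈ X →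
          fd (gen Δ a) * (fg g * r * (fg g)⁻¹) = (fg g * r * (fg g)⁻¹) * fd (gen Δ a) := by
        intro a g h
        have h1 := hr _ h
        have h2 := hconj g (g⁻¹ a)
        rw [RelIso.apply_inv_self] at h2
        rw [← h2]
        simp only [mul_assoc, inv_mul_cancel_left]
        rw [← mul_assoc _ r, h1]
        simp only [mul_assoc]
      rintro (a | g) (b | h) hh
      · have h0 := gen_comm (show Δ.Adj a b from hh)
        simp only [Sum.elim_inl]
        rw [← map_mul, h0, map_mul]
      · exact key a h hh
      · exact (key b g hh).symm
      · exact hh.elim)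
  have hfn1 : ∀ v, fn (gen _ (Sum.inl v)) = fd (gen Δ v) := fun v => rlift_gen _ _ _
  have hfn2 : ∀ g, fn (gen _ (Sum.inr g)) = fg g * r * (fg g)⁻¹ := fun v => rlift_gen _ _ _
  let f : R (lam Δ X) ⋊[ract (lamAct Δ X)] (Δ ≃g Δ) →* K :=
    SemidirectProduct.lift fn fg (by
      intro g
      apply rext
      rintro (v | h)
      · simp only [MonoidHom.comp_apply, MulEquiv.coe_toMonoidHom, ract_gen, lamAct_inl, hfn1,
          MulAut.conj_apply, hconj]
      · simp only [MonoidHom.comp_apply, MulEquiv.coe_toMonoidHom, ract_gen, lamAct_inr, hfn2,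
          MulAut.conj_apply, map_mul fg, mul_inv_rev, mul_assoc])
  have hfF : f.comp F = E := by
    apply HNNExtension.hom_ext
    · apply rext
      intro s
      change f (F (HNNExtension.of (gen Γ s))) = E (HNNExtension.of (gen Γ s))
      have h1 : F (HNNExtension.of (gen Γ s)) = inlj (gen Γ s) := HNNExtension.lift_of _ _ _ _
      have h2 : E (HNNExtension.of (gen Γ s)) = HNNExtension.of (ι (gen Γ s)) :=
        HNNExtension.lift_of _ _ _ _
      rw [h1, h2, hιg]
      simp only [inlj, MonoidHom.comp_apply, hjg, f, SemidirectProduct.lift_inl, hfn1]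
      rfl
    · change f (F HNNExtension.t) = E HNNExtension.t
      have h1 : F HNNExtension.t = tt := HNNExtension.lift_t _ _ _
      have h2 : E HNNExtension.t = HNNExtension.t := HNNExtension.lift_t _ _ _
      rw [h1, h2]
      simp only [tt, map_mul, map_inv, f, SemidirectProduct.lift_inl, SemidirectProduct.lift_inr,
        hfn2, r]
      simp
  have : Function.Injective (f ∘ F) := by
    rw [← MonoidHom.coe_comp, hfF]; exact hE
  exact this.of_comp

end RaagHNN

/-- Every right-angled Artin HNN-extension (all labels in {2, ∞}) contains a
finite-index subgroup that embeds in a right-angled Artin group. -/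
theorem raag_hnn_virtually_embeds
    (S : Type) [Fintype S]
    (m : S → S → ℕ∞)
    (hsymm : ∀ s t, m s t = m t s)
    -- the system is right-angled
    (hra : ∀ s t, s ≠ t → m s t = 2 ∨ m s t = ⊤)
    (S' S'' : Set S) (φ : S → S)
    (hmap : ∀ s ∈ S', φ s ∈ S'')
    (hinj : Set.InjOn φ S')
    (hsurj : S'' ⊆ φ '' S')
    -- φ is label-preserving
    (hpres : ∀ s ∈ S', ∀ t ∈ S', m s t = m (φ s) (φ t)) :
    ∃ (T : Type) (_ : Fintype T) (mT : T → T → ℕ∞),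
      (∀ a b, mT a b = mT b a) ∧
      -- the target Artin group is right-angled
      (∀ a b, a ≠ b → mT a b = 2 ∨ mT a b = ⊤) ∧
      ∃ H : Subgroup (ArtinHNN m S' φ), H.index ≠ 0 ∧
        ∃ ψ : H →* ArtinGroup mT, Function.Injective ψ := by
  classical
  let Γ : SimpleGraph S :=
    { Adj := fun s t => s ≠ t ∧ m s t = 2
      symm := ⟨fun s t h => ⟨h.1.symm, by rw [hsymm]; exact h.2⟩⟩
      loopless := ⟨fun s h => h.1 rfl⟩ }
  have hΓ : ∀ s ∈ S', ∀ t ∈ S', Γ.Adj s t ↔ Γ.Adj (φ s) (φ t) := by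
    intro s hs t ht
    change (s ≠ t ∧ m s t = 2) ↔ (φ s ≠ φ t ∧ m (φ s) (φ t) = 2)
    rw [hpres s hs t ht, (hinj.ne_iff hs ht)]
  obtain ⟨V, hV, Δ, i, σ, hi, hadj, hσ⟩ := RaagHNN.eppa Γ S' φ hinj hΓ
  let α : RaagHNN.R (Γ.comap (Subtype.val : S' → S)) →* RaagHNN.R Γ :=
    RaagHNN.rmap (fun s : S' => φ s) (fun a b h => (hΓ a a.2 b b.2).1 h)
  let β : RaagHNN.R (Γ.comap (Subtype.val : S' → S)) →* RaagHNN.R Γ :=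
    RaagHNN.rmap (fun s : S' => (s : S)) (fun a b h => h)
  have hα : Function.Injective α :=
    RaagHNN.rmap_injective (fun s : S' => φ s) (fun a b h => Subtype.ext (hinj a.2 b.2 h))
      (fun a b => hΓ a a.2 b b.2)
  have hβ : Function.Injective β :=
    RaagHNN.rmap_injective (fun s : S' => (s : S)) Subtype.val_injective (fun a b => Iff.rfl)
  have hαg : ∀ s : S', α (RaagHNN.gen _ s) = RaagHNN.gen Γ (φ s) :=
    fun s => RaagHNN.rmap_gen _ _ _
  have hβg : ∀ s : S', β (RaagHNN.gen _ s) = RaagHNN.gen Γ s :=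
    fun s => RaagHNN.rmap_gen _ _ _
  obtain ⟨F, hF⟩ := RaagHNN.core α β hα hβ hαg hβg i σ hi hadj hσ
  -- the presented group maps injectively to the HNN extension
  let p : S ⊕ Unit → RaagHNN.HN α β hα hβ :=
    Sum.elim (fun s => HNNExtension.of (RaagHNN.gen Γ s)) (fun _ => HNNExtension.t)
  have hp : ∀ r ∈ artinHNNRels m S' φ, FreeGroup.lift p r = 1 := by
    rintro r (⟨s, t, n, hst, hm, rfl⟩ | ⟨s, hs, rfl⟩)
    · have h2 : m s t = 2 := by
        rcases hra s t hst with h | h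
        · exact h
        · rw [hm] at h; exact absurd h (ENat.natCast_ne_top n)
      have hn : n = 2 := by
        rw [h2] at hm; exact_mod_cast hm.symm
      subst hn
      simp only [RaagHNN.altWord_two, map_mul, map_inv, FreeGroup.lift_apply_of]
      rw [mul_inv_eq_one]
      simp only [p, Sum.elim_inl]
      rw [← map_mul, RaagHNN.gen_comm (show Γ.Adj s t from ⟨hst, h2⟩), map_mul]
    · simp only [map_mul, map_inv, FreeGroup.lift_apply_of, p, Sum.elim_inl, Sum.elim_inr]
      have h1 := RaagHNN.hn_rel α β hα hβ (RaagHNN.gen _ ⟨s, hs⟩)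
      rw [hαg, hβg] at h1
      rw [mul_inv_eq_one, mul_assoc, inv_mul_eq_iff_eq_mul]
      exact h1.symm
  let P : ArtinHNN m S' φ →* RaagHNN.HN α β hα hβ :=
    PresentedGroup.toGroup (rels := artinHNNRels m S' φ) (f := p) hp
  let γ : S ⊕ Unit → ArtinHNN m S' φ :=
    fun x => PresentedGroup.of (rels := artinHNNRels m S' φ) x
  have hPγ : ∀ x, P (γ x) = p x := fun x => PresentedGroup.toGroup.of hp
  let q₀ : RaagHNN.R Γ →* ArtinHNN m S' φ := RaagHNN.rlift (fun s => γ (Sum.inl s)) (by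
    intro a b hab
    have h1 : (altWord (Sum.inl a) (Sum.inl b) 2 * (altWord (Sum.inl b) (Sum.inl a) 2)⁻¹) ∈
        artinHNNRels m S' φ := Or.inl ⟨a, b, 2, hab.1, hab.2, rfl⟩
    have h2 := PresentedGroup.one_of_mem h1
    rw [RaagHNN.altWord_two, RaagHNN.altWord_two, map_mul, map_inv, map_mul, map_mul,
      mul_inv_eq_one] at h2
    exact h2)
  have hq₀ : ∀ s, q₀ (RaagHNN.gen Γ s) = γ (Sum.inl s) := fun s => RaagHNN.rlift_gen _ _ _
  have hq : ∀ c, γ (Sum.inr ()) * q₀ (α c) = q₀ (β c) * γ (Sum.inr ()) := by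
    have : q₀.comp α = (MulAut.conj (γ (Sum.inr ()))⁻¹).toMonoidHom.comp (q₀.comp β) := by
      apply RaagHNN.rext
      intro s
      have h1 : ((FreeGroup.of (Sum.inr ()))⁻¹ * FreeGroup.of (Sum.inl (s : S)) *
          FreeGroup.of (Sum.inr ()) * (FreeGroup.of (Sum.inl (φ s)))⁻¹) ∈
          artinHNNRels m S' φ := Or.inr ⟨s, s.2, rfl⟩
      have h2 := PresentedGroup.one_of_mem h1
      rw [map_mul, map_inv, mul_inv_eq_one, map_mul, map_mul, map_inv] at h2
      simp only [MonoidHom.comp_apply, hαg, hβg, hq₀, MulEquiv.coe_toMonoidHom,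
        MulAut.conj_apply, inv_inv]
      exact h2.symm
    intro c
    have h := DFunLike.congr_fun this c
    simp only [MonoidHom.comp_apply, MulEquiv.coe_toMonoidHom, MulAut.conj_apply, inv_inv] at h
    rw [h]
    simp [mul_assoc]
  let q := RaagHNN.hnlift α β hα hβ q₀ (γ (Sum.inr ())) hq
  have hqP : q.comp P = MonoidHom.id _ := by
    apply PresentedGroup.ext (rels := artinHNNRels m S' φ)
    rintro (s | u)
    · change q (P (γ (Sum.inl s))) = γ (Sum.inl s)
      rw [hPγ]
      exact (HNNExtension.lift_of _ _ _ _).trans (hq₀ s)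
    · change q (P (γ (Sum.inr u))) = γ (Sum.inr u)
      rw [hPγ]
      exact HNNExtension.lift_t _ _ _
  have hP : Function.Injective P := by
    have h : Function.Injective (q ∘ P) := by
      rw [← MonoidHom.coe_comp, hqP]; exact fun _ _ h => h
    exact h.of_comp
  have hfin : Finite (Δ ≃g Δ) := DFunLike.finite _
  let W := F.comp P
  have hW : Function.Injective W := hF.comp hP
  let π := SemidirectProduct.rightHom.comp W
  refine ⟨V ⊕ (Δ ≃g Δ), Fintype.ofFinite _, RaagHNN.gm (RaagHNN.lam Δ (Set.image (fun s => i (φ s)) S')), ?_, ?_, π.ker, ?_, ?_⟩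
  · intro a b
    simp only [RaagHNN.gm, SimpleGraph.adj_comm]
  · intro a b _
    unfold RaagHNN.gm
    split_ifs
    · exact Or.inl rfl
    · exact Or.inr rfl
  · rw [Subgroup.index_ker]
    exact Nat.card_pos.ne'
  · have hk : ∀ x : π.ker, (W x).right = 1 := fun x => x.2
    refine ⟨{ toFun := fun x => (W x).left
              map_one' := by simp
              map_mul' := fun x y => by simp [hk] }, ?_⟩
    intro x y hxy
    apply Subtype.ext
    apply hW
    exact SemidirectProduct.ext hxy ((hk x).trans (hk y).symm)
end
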